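/- arXiv:2305.19104 — 5 statements merged into one kernel-verified Lean document; each statement's English description precedes it below -/
import Mathlib

section
/- Every minimal blocking set of a chain of width w ≥ 1 and length ℓ that spreads over d layers has size at least d + w − 1. -/
/-! ## Directed graphs and pebbling -/

structure Dgraph where
  V : Type
  [fintypeV : Fintype V]
  [decEqV : DecidableEq V]
  edge : V → V → Prop

attribute [instance] Dgraph.fintypeV Dgraph.decEqV

namespace Dgraph

/-- A directed graph is acyclic if no vertex lies on a directed cycle. -/
def Acyclic (G : Dgraph) : Prop :=
  ∀ v : G.V, ¬ Relation.TransGen G.edge v v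

def IsSink (G : Dgraph) (z : G.V) : Prop := ∀ u : G.V, ¬ G.edge z u

def IsSource (G : Dgraph) (v : G.V) : Prop := ∀ u : G.V, ¬ G.edge u v

def UniqueSink (G : Dgraph) (z : G.V) : Prop :=
  G.IsSink z ∧ ∀ w : G.V, G.IsSink w → w = z

/-- Every vertex has in-degree at most 2. -/
def InDegLe2 (G : Dgraph) : Prop :=
  ∀ v : G.V, {u : G.V | G.edge u v}.ncard ≤ 2

/-- One step of the reversible pebble game. -/
def RevStep (G : Dgraph) (P P' : Finset G.V) : Prop :=
  (∃ v : G.V, v ∉ P ∧ (∀ u : G.V, G.edge u v → u ∈ P) ∧ P' = insert v P) ∨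
  (∃ v : G.V, v ∈ P ∧ (∀ u : G.V, G.edge u v → u ∈ P) ∧ P' = P.erase v)

/-- One step of the standard pebble game. -/
def StdStep (G : Dgraph) (P P' : Finset G.V) : Prop :=
  (∃ v : G.V, v ∉ P ∧ (∀ u : G.V, G.edge u v → u ∈ P) ∧ P' = insert v P) ∨
  (∃ v : G.V, v ∈ P ∧ P' = P.erase v)

/-- An unconditional reversible pebbling of time `τ`. -/
def IsRevPebbling (G : Dgraph) (P : ℕ → Finset G.V) (τ : ℕ) : Prop :=
  P 0 = ∅ ∧ ∀ t < τ, G.RevStep (P t) (P (t+1))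

/-- An unconditional standard pebbling of time `τ`. -/
def IsStdPebbling (G : Dgraph) (P : ℕ → Finset G.V) (τ : ℕ) : Prop :=
  P 0 = ∅ ∧ ∀ t < τ, G.StdStep (P t) (P (t+1))

/-- The space of a pebbling. -/
def space (G : Dgraph) (P : ℕ → Finset G.V) (τ : ℕ) : ℕ :=
  (Finset.range (τ+1)).sup fun t => (P t).card

/-- Persistent (reversible) pebbling price of a vertex. -/
noncomputable def pers (G : Dgraph) (v : G.V) : ℕ :=
  sInf { s : ℕ | ∃ P τ, G.IsRevPebbling P τ ∧ P τ = {v} ∧ G.space P τ = s }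

/-- Visiting (reversible) pebbling price of a vertex. -/
noncomputable def visit (G : Dgraph) (v : G.V) : ℕ :=
  sInf { s : ℕ | ∃ P τ, G.IsRevPebbling P τ ∧ v ∈ P τ ∧ G.space P τ = s }

/-- Surrounding (reversible) pebbling price of a vertex. -/
noncomputable def surround (G : Dgraph) (v : G.V) : ℕ :=
  sInf { s : ℕ | ∃ P τ, G.IsRevPebbling P τ ∧ (∀ u : G.V, G.edge u v → u ∈ P τ) ∧
    G.space P τ = s }

/-- Standard pebbling price of a vertex. -/
noncomputable def black (G : Dgraph) (z : G.V) : ℕ :=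
  sInf { s : ℕ | ∃ P τ, G.IsStdPebbling P τ ∧ P τ = {z} ∧ G.space P τ = s }

/-- Space of a pebbling counted only inside the region `R`. -/
noncomputable def spaceIn (G : Dgraph) (R : Set G.V) (P : ℕ → Finset G.V) (τ : ℕ) : ℕ :=
  (Finset.range (τ+1)).sup fun t => ((P t : Set G.V) ∩ R).ncard

/-- `R`-restricted persistent price. -/
noncomputable def persIn (G : Dgraph) (R : Set G.V) (v : G.V) : ℕ :=
  sInf { s : ℕ | ∃ P τ, G.IsRevPebbling P τ ∧ ((P τ : Set G.V) ∩ R) = {v} ∧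
    G.spaceIn R P τ = s }

/-- `R`-restricted visiting price. -/
noncomputable def visitIn (G : Dgraph) (R : Set G.V) (v : G.V) : ℕ :=
  sInf { s : ℕ | ∃ P τ, G.IsRevPebbling P τ ∧ v ∈ P τ ∧ G.spaceIn R P τ = s }

/-- `R`-restricted surrounding price. -/
noncomputable def surroundIn (G : Dgraph) (R : Set G.V) (v : G.V) : ℕ :=
  sInf { s : ℕ | ∃ P τ, G.IsRevPebbling P τ ∧ (∀ u : G.V, G.edge u v → u ∈ P τ) ∧
    G.spaceIn R P τ = s }

/-- `B` blocks the graph: every directed path from a source to a sink meets `B`. -/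
def Blocks (G : Dgraph) (B : Set G.V) : Prop :=
  ∀ (p : List G.V) (hp : p ≠ []), List.Chain' G.edge p →
    G.IsSource (p.head hp) → G.IsSink (p.getLast hp) → ∃ v ∈ p, v ∈ B

/-- A minimal blocking set. -/
def MinBlocking (G : Dgraph) (B : Set G.V) : Prop :=
  G.Blocks B ∧ ∀ B' : Set G.V, B' ⊂ B → ¬ G.Blocks B'

end Dgraph

/-! ## Concrete graph families -/

/-- The function `g` with `g 1 = 0` and `g Δ = 2^(g (Δ-1) + Δ - 2) + g (Δ-1)` for `Δ ≥ 2`. -/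
def g : ℕ → ℕ
  | 0 => 0
  | 1 => 0
  | (n+2) => 2 ^ (g (n+1) + n) + g (n+1)

/-- `ginv h = min {Δ ≥ 1 | g Δ ≥ h}`. -/
noncomputable def ginv (h : ℕ) : ℕ := sInf { Δ : ℕ | 1 ≤ Δ ∧ h ≤ g Δ }

/-- The pyramid of height `h`: vertices `(i,j)` with `i ≤ j ≤ h`, vertex `(i,j)` is
at level `i`, with edges `(i,j) → (i+1,j)` and `(i,j) → (i+1,j+1)` (when the target
is a vertex). -/
def pyramid (h : ℕ) : Dgraph where
  V := {p : Fin (h+1) × Fin (h+1) // (p.1 : ℕ) ≤ (p.2 : ℕ)}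
  edge u v := (v.1.1 : ℕ) = (u.1.1 : ℕ) + 1 ∧
    ((v.1.2 : ℕ) = (u.1.2 : ℕ) ∨ (v.1.2 : ℕ) = (u.1.2 : ℕ) + 1)

/-- The sink `(h,h)` of the pyramid of height `h`. -/
def pyramidSink (h : ℕ) : (pyramid h).V := ⟨(Fin.last h, Fin.last h), le_refl _⟩

/-- The complete binary tree of height `h`, with edges directed towards the root:
the vertex `⟨k, j⟩` is the `j`-th node at depth `k`, and its parent is `⟨k-1, j/2⟩`. -/
def bintree (h : ℕ) : Dgraph where
  V := Σ k : Fin (h+1), Fin (2 ^ (k : ℕ))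
  edge u v := (u.1 : ℕ) = (v.1 : ℕ) + 1 ∧ (u.2 : ℕ) / 2 = (v.2 : ℕ)

/-- The root (unique sink) of the complete binary tree. -/
def bintreeRoot (h : ℕ) : (bintree h).V := ⟨0, ⟨0, by positivity⟩⟩

/-- The chain of width `w` and length `ℓ`: layers `0,…,ℓ` of `w` vertices each, where the
`j`-th vertex of layer `i ≥ 1` has incoming edges from the `j`-th and `(j+1 mod w)`-th
vertices of layer `i-1`. -/
def chainDag (w ℓ : ℕ) : Dgraph where
  V := Fin (ℓ+1) × Fin w
  edge u v := (v.1 : ℕ) = (u.1 : ℕ) + 1 ∧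
    ((u.2 : ℕ) = (v.2 : ℕ) ∨ (u.2 : ℕ) = ((v.2 : ℕ) + 1) % w)

/-- The road of width `w` and length `ℓ`: a chain of width `w` and length `ℓ-w+1`
(layers `0,…,ℓ-w+1`) followed by a pyramid of height `w-1` whose sources are the vertices
of layer `ℓ-w+1`; layer `i` consists of the vertices `(i,j)` with `i + j ≤ ℓ`, `j < w`. -/
def road (w ℓ : ℕ) : Dgraph where
  V := {p : Fin (ℓ+1) × Fin w // (p.1 : ℕ) + (p.2 : ℕ) ≤ ℓ}
  edge u v := (v.1.1 : ℕ) = (u.1.1 : ℕ) + 1 ∧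
    ((u.1.2 : ℕ) = (v.1.2 : ℕ) ∨ (u.1.2 : ℕ) = ((v.1.2 : ℕ) + 1) % w)

/-- The sink of the road: the single vertex on the last layer. -/
def roadSink (w ℓ : ℕ) (hw : 0 < w) : (road w ℓ).V :=
  ⟨(Fin.last ℓ, ⟨0, hw⟩), by simp⟩

/-- The directed path of length `h`: vertices `0,…,h` and edges `i → i+1`. -/
def pathDag (h : ℕ) : Dgraph where
  V := Fin (h+1)
  edge u v := (v : ℕ) = (u : ℕ) + 1

/-- The sink of the directed path. -/
def pathSink (h : ℕ) : (pathDag h).V := Fin.last h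

/-- The `(h,ℓ)`-teabag: the pyramid of height `h` with a directed path of length `ℓ`
appended to its sink.  Layer `t ≤ h` consists of the pyramid vertices `(t,j)`, `t ≤ j ≤ h`,
and layer `t > h` consists of the single path vertex `(t,h)`. -/
def teabag (h ℓ : ℕ) : Dgraph where
  V := {p : Fin (h+ℓ+1) × Fin (h+1) //
          ((p.1 : ℕ) ≤ h → (p.1 : ℕ) ≤ (p.2 : ℕ)) ∧ (h ≤ (p.1 : ℕ) → (p.2 : ℕ) = h)}
  edge u v := (v.1.1 : ℕ) = (u.1.1 : ℕ) + 1 ∧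
    ((v.1.2 : ℕ) = (u.1.2 : ℕ) ∨ (v.1.2 : ℕ) = (u.1.2 : ℕ) + 1)

/-- The sink of the `(h,ℓ)`-teabag: the final path vertex. -/
def teabagSink (h ℓ : ℕ) : (teabag h ℓ).V :=
  ⟨(Fin.last (h+ℓ), Fin.last h), by refine ⟨fun hh => ?_, fun _ => ?_⟩ <;> simp_all⟩

/-- The molding `mold G` of a graph `G`: vertices `s` (= `none`), `v^in` (= `some (v,false)`)
and `v^out` (= `some (v,true)`) for `v ∈ V(G)`, with edges `v^in → v^out`,
`u^out → v^in` for every edge `(u,v)` of `G`, and `s → v^out` for every `v`. -/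
def mold (G : Dgraph) : Dgraph where
  V := Option (G.V × Bool)
  edge u v :=
    match u, v with
    | none, some (_, true) => True
    | some (a, false), some (b, true) => a = b
    | some (a, true), some (b, false) => G.edge a b
    | _, _ => False

/-- The special source `s` of `mold G`. -/
def moldSrc (G : Dgraph) : (mold G).V := none

/-- The vertex `v^out` of `mold G`. -/
def moldOut (G : Dgraph) (v : G.V) : (mold G).V := some (v, true)

/-- Column relation of edges of the chain: `k` (lower layer) to `j` (upper layer). -/
def ChStep (w : ℕ) (k j : Fin w) : Prop := (k : ℕ) = (j : ℕ) ∨ (k : ℕ) = ((j : ℕ) + 1) % w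

/-- The columns of the vertices of `B` in layer `i`. -/
def ChLayer {w ℓ : ℕ} (B : Set (chainDag w ℓ).V) (i : ℕ) : Set (Fin w) :=
  {j | ∃ h : i < ℓ + 1, ((⟨i, h⟩, j) : Fin (ℓ+1) × Fin w) ∈ B}

/-- Infinite column paths. -/
def ChPath (w : ℕ) (p : ℕ → Fin w) : Prop := ∀ i, ChStep w (p i) (p (i+1))

lemma chPath_splice {w : ℕ} {p q : ℕ → Fin w} (hp : ChPath w p) (hq : ChPath w q) (i : ℕ)
    (h : ChStep w (p i) (q (i+1))) : ChPath w (fun k => if k ≤ i then p k else q k) := by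
  intro k
  rcases lt_trichotomy k i with hk | hk | hk
  · have h1 : k ≤ i := by omega
    have h2 : k + 1 ≤ i := by omega
    simpa [h1, h2] using hp k
  · subst hk
    simpa using h
  · have h1 : ¬ k ≤ i := by omega
    have h2 : ¬ k + 1 ≤ i := by omega
    simpa [h1, h2] using hq k

lemma chPath_const {w : ℕ} (j : Fin w) : ChPath w (fun _ => j) := fun _ => Or.inl rfl

lemma chBlocks_path {w ℓ : ℕ} {B : Set (chainDag w ℓ).V} (hB : (chainDag w ℓ).Blocks B)
    (p : ℕ → Fin w) (hp : ChPath w p) : ∃ i, p i ∈ ChLayer B i := by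
  let L : List (chainDag w ℓ).V := List.ofFn (fun i : Fin (ℓ+1) => ((i, p i) : Fin (ℓ+1) × Fin w))
  have hlen : L.length = ℓ + 1 := List.length_ofFn
  have hne : L ≠ [] := by
    intro h; rw [h] at hlen; simp at hlen
  have hget : ∀ (n : ℕ) (hn : n < L.length),
      L[n] = ((⟨n, by omega⟩, p n) : Fin (ℓ+1) × Fin w) := by
    intro n hn
    exact List.getElem_ofFn (f := fun i : Fin (ℓ+1) => ((i, p i) : Fin (ℓ+1) × Fin w)) hn
  obtain ⟨v, hv, hvB⟩ := hB L hne (by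
      refine List.isChain_iff_getElem.2 ?_
      intro i hi
      rw [hget, hget]
      exact ⟨rfl, hp i⟩) (by
      rw [List.head_eq_getElem, hget]
      intro u hu
      have := hu.1
      simp at this) (by
      rw [List.getLast_eq_getElem, hget]
      intro u hu
      have := hu.1
      have h2 := u.1.2
      simp only at this
      omega)
  obtain ⟨i, rfl⟩ := (List.mem_ofFn' _ _).1 hv
  exact ⟨i, i.2, hvB⟩

lemma chNotBlocks_path {w ℓ : ℕ} (hw : 1 ≤ w) {B : Set (chainDag w ℓ).V}
    (hB : ¬ (chainDag w ℓ).Blocks B) :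
    ∃ p : ℕ → Fin w, ChPath w p ∧ ∀ i, p i ∉ ChLayer B i := by
  unfold Dgraph.Blocks at hB
  push Not at hB
  obtain ⟨L, hne, hch, hs, ht, hav⟩ := hB
  have hpos : 0 < L.length := List.length_pos_iff.2 hne
  rw [List.head_eq_getElem] at hs
  rw [List.getLast_eq_getElem] at ht
  have hch' := List.isChain_iff_getElem.1 hch
  have h0 : ((L[0]).1 : ℕ) = 0 := by
    by_contra hcon
    have h2 := (L[0]).1.2
    refine hs ((⟨((L[0]).1 : ℕ) - 1, by omega⟩, (L[0]).2) : Fin (ℓ+1) × Fin w) ⟨?_, Or.inl rfl⟩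
    simp only
    omega
  have hlay : ∀ n (hn : n < L.length), ((L[n]).1 : ℕ) = n := by
    intro n
    induction n with
    | zero => intro _; exact h0
    | succ n ih =>
      intro hn
      have := (hch' n hn).1
      rw [this, ih]
  have hlast : ℓ < L.length := by
    by_contra hcon
    have h2 := hlay (L.length - 1) (by omega)
    refine ht ((⟨((L[L.length - 1]).1 : ℕ) + 1, by omega⟩, (L[L.length-1]).2) : Fin (ℓ+1) × Fin w)
      ⟨rfl, Or.inl rfl⟩
  refine ⟨fun n => if h : n < L.length then (L[n]).2 else (L[L.length - 1]).2, ?_, ?_⟩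
  · intro i
    by_cases h1 : i + 1 < L.length
    · have h2 : i < L.length := by omega
      simp only [h1, h2, dif_pos]
      exact (hch' i h1).2
    · by_cases h2 : i < L.length
      · have h3 : i = L.length - 1 := by omega
        simp only [h1, h2, dif_pos, dif_neg, not_false_eq_true]
        subst h3
        exact Or.inl rfl
      · simp only [h1, h2, dif_neg, not_false_eq_true]
        exact Or.inl rfl
  · rintro i ⟨hi, hmem⟩
    have h2 : i < L.length := by omega
    simp only [h2, dif_pos] at hmem
    refine hav L[i] (List.getElem_mem h2) ?_
    have heq : L[i] = ((⟨i, hi⟩, (L[i]).2) : Fin (ℓ+1) × Fin w) :=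
      Prod.ext (Fin.ext (hlay i h2)) rfl
    rw [heq]
    exact hmem

lemma chMin_path {w ℓ : ℕ} (hw : 1 ≤ w) {B : Set (chainDag w ℓ).V}
    (hB : (chainDag w ℓ).MinBlocking B) {i : ℕ} {j : Fin w} (hj : j ∈ ChLayer B i) :
    ∃ p : ℕ → Fin w, ChPath w p ∧ p i = j ∧ ∀ k, k ≠ i → p k ∉ ChLayer B k := by
  obtain ⟨hi, hmem⟩ := hj
  obtain ⟨p, hp, hav⟩ := chNotBlocks_path hw
    (hB.2 (B \ {((⟨i, hi⟩, j) : Fin (ℓ+1) × Fin w)}) (Set.sdiff_singleton_ssubset.2 hmem))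
  have key : ∀ k, p k ∈ ChLayer B k → k = i ∧ p k = j := by
    rintro k ⟨hk, hkm⟩
    by_contra hcon
    refine hav k ⟨hk, hkm, ?_⟩
    intro heq
    have h1 : ((⟨k, hk⟩, p k) : Fin (ℓ+1) × Fin w) = (⟨i, hi⟩, j) := heq
    rw [Prod.mk.injEq, Fin.mk.injEq] at h1
    exact hcon h1
  obtain ⟨k, hk⟩ := chBlocks_path hB.1 p hp
  obtain ⟨rfl, h2⟩ := key k hk
  exact ⟨p, hp, h2, fun m hm hmem => hm (key m hmem).1⟩

open Classical in
lemma chExpand {w : ℕ} (A N : Finset (Fin w)) (hN : ∀ k ∈ A, ∀ j, ChStep w k j → j ∈ N)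
    (hne : A.Nonempty) (hnu : ∃ j, j ∉ A) : A.card + 1 ≤ N.card := by
  have hsub : A ⊆ N := fun k hk => hN k hk k (Or.inl rfl)
  obtain ⟨j, hj⟩ := hnu
  have hw : 0 < w := j.pos
  have hex : ∃ x, x ∉ A ∧ x ∈ N := by
    by_contra hcon
    push Not at hcon
    have hall : ∀ n : ℕ, (⟨((j : ℕ) + n) % w, Nat.mod_lt _ hw⟩ : Fin w) ∉ A := by
      intro n
      induction n with
      | zero => 
        have : (⟨((j : ℕ) + 0) % w, Nat.mod_lt _ hw⟩ : Fin w) = j := by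
          apply Fin.ext; simp [Nat.mod_eq_of_lt j.2]
        rwa [this]
      | succ n ih =>
        intro hmem
        refine hcon _ ih (hN _ hmem _ (Or.inr ?_))
        simp [← add_assoc]
    obtain ⟨y, hy⟩ := hne
    apply hall (w - j + y)
    have : (⟨((j : ℕ) + (w - j + y)) % w, Nat.mod_lt _ hw⟩ : Fin w) = y := by
      apply Fin.ext
      have h1 : (j : ℕ) + (w - j + y) = y + w := by have := j.2; omega
      simp [h1, Nat.mod_eq_of_lt y.2]
    rwa [this]
  obtain ⟨x, hx, hxN⟩ := hex
  exact Finset.card_lt_card (Finset.ssubset_iff_subset_ne.2 ⟨hsub, fun h => hx (h ▸ hxN)⟩)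

/-- A minimal blocking set of a chain spreading over `d` layers has at least `d + w - 1`
vertices (Lemma `lem:separator-is-large`). -/
theorem chain_separator_is_large
    (w ℓ : ℕ) (hw : 1 ≤ w) (B : Set (chainDag w ℓ).V)
    (hB : (chainDag w ℓ).MinBlocking B) (a b d : ℕ)
    (ha : ∃ v ∈ B, ((v : (chainDag w ℓ).V).1 : ℕ) = a)
    (hb : ∃ v ∈ B, ((v : (chainDag w ℓ).V).1 : ℕ) = b)
    (hbetween : ∀ v ∈ B, a ≤ ((v : (chainDag w ℓ).V).1 : ℕ) ∧ ((v : (chainDag w ℓ).V).1 : ℕ) ≤ b)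
    (hd : d = b - a + 1) :
    d + w - 1 ≤ B.ncard := by
  classical
  let Bl : ℕ → Finset (Fin w) := fun i => Finset.univ.filter (fun j => j ∈ ChLayer B i)
  let A : ℕ → Finset (Fin w) := fun i => Finset.univ.filter
    (fun j => ∃ p, ChPath w p ∧ p i = j ∧ ∀ k ≤ i, p k ∉ ChLayer B k)
  have hBl : ∀ i j, j ∈ Bl i ↔ j ∈ ChLayer B i := fun i j => by simp [Bl]
  have hA : ∀ i j, j ∈ A i ↔ ∃ p, ChPath w p ∧ p i = j ∧ ∀ k ≤ i, p k ∉ ChLayer B k :=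
    fun i j => by simp [A]
  have hrange : ∀ i j, j ∈ ChLayer B i → a ≤ i ∧ i ≤ b := by
    rintro i j ⟨h, hm⟩
    exact hbetween _ hm
  obtain ⟨va, hva, rfl⟩ := ha
  obtain ⟨vb, hvb, rfl⟩ := hb
  have hva' : va.2 ∈ ChLayer B va.1 := ⟨va.1.2, hva⟩
  have hvb' : vb.2 ∈ ChLayer B vb.1 := ⟨vb.1.2, hvb⟩
  generalize hae : (va.1 : ℕ) = a at *
  generalize hbe : (vb.1 : ℕ) = b at *
  have hab : a ≤ b := (hrange _ _ hva').2
  obtain ⟨pa, hpa, -, hpaav⟩ := chMin_path hw hB hva'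
  obtain ⟨pb, hpb, -, hpbav⟩ := chMin_path hw hB hvb'
  have hstep : ∀ i, a ≤ i → i < b → (A i).card + 1 ≤ (A (i+1)).card + (Bl (i+1)).card := by
    intro i hai hib
    rw [← Finset.card_union_of_disjoint]
    · apply chExpand
      · intro k hk j hkj
        rw [Finset.mem_union, hBl, or_iff_not_imp_right]
        intro hj
        obtain ⟨p, hp, rfl, hav⟩ := (hA _ _).1 hk
        refine (hA _ _).2 ⟨_, chPath_splice hp (chPath_const j) i hkj, by simp, ?_⟩
        intro k hk
        by_cases hki : k ≤ i
        · simpa [hki] using hav k hki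
        · have : k = i + 1 := by omega
          subst this
          simpa using hj
      · exact ⟨pb i, (hA _ _).2 ⟨pb, hpb, rfl, fun k hk => hpbav k (by omega)⟩⟩
      · refine ⟨pa i, fun hmem => ?_⟩
        obtain ⟨q, hq, hqi, hav⟩ := (hA _ _).1 hmem
        obtain ⟨k, hk⟩ := chBlocks_path hB.1 _
          (chPath_splice hq hpa i (by rw [hqi]; exact hpa i))
        by_cases hki : k ≤ i
        · simp only [hki, if_true] at hk
          exact hav k hki hk
        · simp only [hki, if_false] at hk
          exact hpaav k (by omega) hk
    · rw [Finset.disjoint_left]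
      intro j hj hj2
      obtain ⟨p, hp, rfl, hav⟩ := (hA _ _).1 hj
      exact hav _ le_rfl ((hBl _ _).1 hj2)
  have hbase : w ≤ (A a).card + (Bl a).card := by
    have : (Finset.univ : Finset (Fin w)) ⊆ A a ∪ Bl a := by
      intro j _
      rw [Finset.mem_union, hBl, or_iff_not_imp_right]
      intro hj
      refine (hA _ _).2 ⟨_, chPath_const j, rfl, fun k hk hmem => ?_⟩
      have := (hrange _ _ hmem).1
      have hka : k = a := by omega
      subst hka
      exact hj hmem
    have h1 := Finset.card_le_card this
    rw [Finset.card_univ, Fintype.card_fin] at h1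
    exact h1.trans (Finset.card_union_le _ _)
  have hsum : ∀ n, a + n ≤ b →
      w + n ≤ (A (a+n)).card + ∑ k ∈ Finset.Icc a (a+n), (Bl k).card := by
    intro n
    induction n with
    | zero => intro _; simpa using hbase
    | succ n ih =>
      intro hn
      have h1 := ih (by omega)
      have h2 := hstep (a+n) (by omega) (by omega)
      rw [← add_assoc a n 1, Finset.sum_Icc_succ_top (by omega)]
      omega
  have hAb : A b = ∅ := by
    rw [Finset.eq_empty_iff_forall_notMem]
    intro j hj
    obtain ⟨p, hp, rfl, hav⟩ := (hA _ _).1 hj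
    obtain ⟨k, hk⟩ := chBlocks_path hB.1 p hp
    exact hav k (hrange _ _ hk).2 hk
  have hfin := hsum (b - a) (by omega)
  rw [show a + (b - a) = b by omega, hAb, Finset.card_empty, zero_add] at hfin
  have hcard : ∑ k ∈ Finset.Icc a b, (Bl k).card ≤ B.ncard := by
    rw [Set.ncard_eq_toFinset_card', Finset.card_eq_sum_card_fiberwise
      (f := fun v : (chainDag w ℓ).V => (v.1 : ℕ)) (t := Finset.Icc a b)]
    · apply Finset.sum_le_sum
      intro k _
      refine le_trans (Finset.card_le_card ?_) (Finset.card_image_le (f := fun v => v.2))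
      intro j hj
      obtain ⟨h, hm⟩ := (hBl _ _).1 hj
      rw [Finset.mem_image]
      refine ⟨_, Finset.mem_filter.2 ⟨Set.mem_toFinset.2 hm, rfl⟩, rfl⟩
    · intro v hv
      exact Finset.mem_coe.2 (Finset.mem_Icc.2 (hbetween v (by simpa using hv)))
  omega
end

section
/- Every minimal blocking set B of a road of width w and length ℓ that spreads over d layers has size at least d + q − 1, where q is the number of vertices in the highest layer containing a vertex of B. -/
namespace RoadAux

/-- Columns of layer `i`. -/
def L (w ℓ i : ℕ) : Finset ℕ := (Finset.range w).filter fun j => i + j ≤ ℓ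

open Classical in
/-- Columns of the elements of `B` in layer `i`. -/
noncomputable def Bn {w ℓ : ℕ} (B : Set (road w ℓ).V) (i : ℕ) : Finset ℕ :=
  (L w ℓ i).filter fun j => ∃ v ∈ B, (v.1.1 : ℕ) = i ∧ (v.1.2 : ℕ) = j

/-- Columns of the out-neighbours in layer `i+1` of a set of columns in layer `i`. -/
def N (w ℓ i : ℕ) (U : Finset ℕ) : Finset ℕ :=
  (L w ℓ (i+1)).filter fun j => j ∈ U ∨ (j + 1) % w ∈ U

/-- Columns of layer `i` reachable from the sources while avoiding `B`. -/
noncomputable def U {w ℓ : ℕ} (B : Set (road w ℓ).V) : ℕ → Finset ℕ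
  | 0 => L w ℓ 0 \ Bn B 0
  | (i+1) => N w ℓ i (U B i) \ Bn B (i+1)

/-- `c` describes a source-sink path up to layer `n`. -/
def IsPath (w ℓ n : ℕ) (c : ℕ → ℕ) : Prop :=
  (∀ k ≤ n, c k ∈ L w ℓ k) ∧ ∀ k < n, c k = c (k+1) ∨ c k = (c (k+1) + 1) % w

lemma mem_L {w ℓ i j : ℕ} : j ∈ L w ℓ i ↔ j < w ∧ i + j ≤ ℓ := by
  simp [L]

lemma L_eq (w ℓ i : ℕ) (hi : i ≤ ℓ) : L w ℓ i = Finset.range (min w (ℓ - i + 1)) := by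
  ext j; simp only [mem_L, Finset.mem_range]; omega

lemma expand (w ℓ i : ℕ) (hi : i < ℓ) (S : Finset ℕ) (hS : S ⊆ L w ℓ i)
    (hne : S.Nonempty) (hpr : S ≠ L w ℓ i) :
    S.card + 1 + (L w ℓ (i+1)).card ≤ (N w ℓ i S).card + (L w ℓ i).card := by
  have hx : ∃ x ∈ L w ℓ i, x ∉ S := by
    by_contra! h
    exact hpr (Finset.Subset.antisymm hS h)
  obtain ⟨x, hxL, hxS⟩ := hx
  have hxL' := mem_L.1 hxL
  by_cases hc : i + w ≤ ℓ
  · have e1 : (L w ℓ i).card = w := by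
      rw [L_eq w ℓ i hi.le, Finset.card_range]; omega
    have e2 : (L w ℓ (i+1)).card = w := by
      rw [L_eq w ℓ (i+1) hi, Finset.card_range]; omega
    have hex : ∃ j < w, j ∉ S ∧ (j + 1) % w ∈ S := by
      by_contra! h
      have hdown : ∀ y, y < w → y ∈ S → ∀ j ≤ y, j ∈ S := by
        intro y
        induction y with
        | zero => intro _ h0 j hj; obtain rfl : j = 0 := by omega
                  exact h0
        | succ y ih =>
          intro hy hyS j hj
          rcases Nat.eq_or_lt_of_le hj with rfl | hlt
          · exact hyS
          · refine ih (by omega) ?_ j (by omega)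
            by_contra hn
            exact h y (by omega) hn (by rwa [Nat.mod_eq_of_lt hy])
      obtain ⟨y, hy⟩ := hne
      have hyw := (mem_L.1 (hS hy)).1
      have h0 : 0 ∈ S := hdown y hyw hy 0 (Nat.zero_le _)
      have hl : w - 1 ∈ S := by
        by_contra hn
        refine h (w-1) (by omega) hn ?_
        rw [show w - 1 + 1 = w by omega, Nat.mod_self]; exact h0
      exact hxS (hdown (w-1) (by omega) hl x (by omega))
    obtain ⟨j, hj, hjS, hj1⟩ := hex
    have hsub : insert j S ⊆ N w ℓ i S := by
      intro y hy
      rw [Finset.mem_insert] at hy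
      rw [N, Finset.mem_filter, mem_L]
      rcases hy with rfl | hy
      · exact ⟨⟨hj, by omega⟩, Or.inr hj1⟩
      · have := mem_L.1 (hS hy)
        exact ⟨⟨this.1, by omega⟩, Or.inl hy⟩
    have := Finset.card_le_card hsub
    rw [Finset.card_insert_of_notMem hjS] at this
    omega
  · have e : (L w ℓ i).card = (L w ℓ (i+1)).card + 1 := by
      rw [L_eq w ℓ i hi.le, L_eq w ℓ (i+1) hi, Finset.card_range, Finset.card_range]; omega
    have : S.card ≤ (N w ℓ i S).card := by
      refine Finset.card_le_card_of_injOn (fun u => if u < x then u else u - 1) ?_ ?_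
      · intro u hu
        have hu : u ∈ S := hu
        have huL := mem_L.1 (hS hu)
        have hux : u ≠ x := fun h => hxS (h ▸ hu)
        simp only [Finset.mem_coe, N, Finset.mem_filter, mem_L]
        split_ifs with h
        · exact ⟨by omega, Or.inl hu⟩
        · refine ⟨by omega, Or.inr ?_⟩
          rw [show u - 1 + 1 = u by omega, Nat.mod_eq_of_lt huL.1]; exact hu
      · intro u hu v hv huv
        have hux : u ≠ x := fun h => hxS (h ▸ hu)
        have hvx : v ≠ x := fun h => hxS (h ▸ hv)
        simp only at huv
        split_ifs at huv <;> omega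
    omega

lemma U_sub {w ℓ : ℕ} (B : Set (road w ℓ).V) (i : ℕ) : U B i ⊆ L w ℓ i := by
  cases i with
  | zero => exact Finset.sdiff_subset
  | succ i => exact Finset.sdiff_subset.trans (Finset.filter_subset _ _)

lemma U_succ {w ℓ : ℕ} (B : Set (road w ℓ).V) (i j : ℕ) :
    j ∈ U B (i+1) ↔ (j ∈ L w ℓ (i+1) ∧ (j ∈ U B i ∨ (j+1) % w ∈ U B i)) ∧ j ∉ Bn B (i+1) := by
  simp [U, N]

lemma U_path {w ℓ : ℕ} (B : Set (road w ℓ).V) (i : ℕ) : ∀ j ∈ U B i,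
    ∃ c, IsPath w ℓ i c ∧ c i = j ∧ ∀ k ≤ i, c k ∉ Bn B k := by
  induction i with
  | zero =>
    intro j hj
    have h1 := U_sub B 0 hj
    have h2 : j ∉ Bn B 0 := (Finset.mem_sdiff.1 hj).2
    refine ⟨fun _ => j, ⟨?_, fun k hk => by omega⟩, rfl, ?_⟩
    · intro k hk; obtain rfl : k = 0 := by omega
      exact h1
    · intro k hk; obtain rfl : k = 0 := by omega
      exact h2
  | succ i ih =>
    intro j hj
    obtain ⟨⟨hL, hor⟩, hB⟩ := (U_succ B i j).1 hj
    have : ∃ j' ∈ U B i, j' = j ∨ j' = (j+1) % w := by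
      rcases hor with h | h
      · exact ⟨_, h, Or.inl rfl⟩
      · exact ⟨_, h, Or.inr rfl⟩
    obtain ⟨j', hj', hjj⟩ := this
    obtain ⟨c, ⟨hc1, hc2⟩, hci, hcB⟩ := ih j' hj'
    refine ⟨fun k => if k ≤ i then c k else j, ⟨?_, ?_⟩, by simp, ?_⟩
    · intro k hk
      by_cases h : k ≤ i
      · simp only [h, if_true]; exact hc1 k h
      · obtain rfl : k = i + 1 := by omega
        simpa using hL
    · intro k hk
      by_cases h : k < i
      · have h1 : k ≤ i := h.le
        have h2 : k + 1 ≤ i := h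
        simp only [h1, h2, if_true]; exact hc2 k h
      · obtain rfl : k = i := by omega
        simpa [hci] using hjj
    · intro k hk
      by_cases h : k ≤ i
      · simp only [h, if_true]; exact hcB k h
      · obtain rfl : k = i + 1 := by omega
        simpa using hB

lemma path_U_step {w ℓ : ℕ} (B : Set (road w ℓ).V) (c : ℕ → ℕ) (hc : IsPath w ℓ ℓ c)
    (k : ℕ) (hk : k < ℓ) (h : c k ∈ U B k) (hB : c (k+1) ∉ Bn B (k+1)) :
    c (k+1) ∈ U B (k+1) := by
  rw [U_succ]
  refine ⟨⟨hc.1 _ hk, ?_⟩, hB⟩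
  rcases hc.2 k hk with h1 | h1
  · left; rwa [← h1]
  · right; rwa [← h1]

/-- vertex of the road from its coordinates. -/
def mk {w ℓ : ℕ} (i j : ℕ) (h : j ∈ L w ℓ i) : (road w ℓ).V :=
  ⟨(⟨i, by have := mem_L.1 h; omega⟩, ⟨j, (mem_L.1 h).1⟩), (mem_L.1 h).2⟩

lemma memL_of {w ℓ : ℕ} (v : (road w ℓ).V) : (v.1.2 : ℕ) ∈ L w ℓ (v.1.1 : ℕ) :=
  mem_L.2 ⟨v.1.2.2, v.2⟩

lemma V_ext {w ℓ : ℕ} (u v : (road w ℓ).V) (h1 : (u.1.1 : ℕ) = v.1.1)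
    (h2 : (u.1.2 : ℕ) = v.1.2) : u = v :=
  Subtype.ext (Prod.ext (Fin.ext h1) (Fin.ext h2))

lemma mem_Bn {w ℓ : ℕ} (B : Set (road w ℓ).V) (v : (road w ℓ).V) :
    (v.1.2 : ℕ) ∈ Bn B (v.1.1 : ℕ) ↔ v ∈ B := by
  classical
  rw [Bn, Finset.mem_filter]
  constructor
  · rintro ⟨_, u, hu, h1, h2⟩
    rwa [← V_ext u v h1 h2]
  · intro h
    exact ⟨memL_of v, v, h, rfl, rfl⟩

lemma layer_source {w ℓ : ℕ} (v : (road w ℓ).V) :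
    (road w ℓ).IsSource v ↔ (v.1.1 : ℕ) = 0 := by
  constructor
  · intro h
    by_contra hn
    have hv := mem_L.1 (memL_of v)
    refine h (mk ((v.1.1 : ℕ) - 1) (v.1.2 : ℕ) (mem_L.2 ⟨hv.1, by omega⟩)) ⟨?_, Or.inl rfl⟩
    simp only [mk]; omega
  · intro h u hu
    have := hu.1
    omega

lemma layer_sink {w ℓ : ℕ} (v : (road w ℓ).V) :
    (road w ℓ).IsSink v ↔ (v.1.1 : ℕ) = ℓ := by
  have hv := mem_L.1 (memL_of v)
  constructor
  · intro h
    by_contra hn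
    by_cases hc : (v.1.1 : ℕ) + 1 + (v.1.2 : ℕ) ≤ ℓ
    · exact h (mk ((v.1.1 : ℕ) + 1) (v.1.2 : ℕ) (mem_L.2 ⟨hv.1, hc⟩)) ⟨rfl, Or.inl rfl⟩
    · refine h (mk ((v.1.1 : ℕ) + 1) ((v.1.2 : ℕ) - 1) (mem_L.2 ⟨by omega, by omega⟩))
        ⟨rfl, Or.inr ?_⟩
      simp only [mk]
      rw [show (v.1.2 : ℕ) - 1 + 1 = v.1.2 by omega, Nat.mod_eq_of_lt hv.1]
  · intro h u hu
    have := hu.1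
    have := u.1.1.2
    omega

lemma blocks_iff {w ℓ : ℕ} (B : Set (road w ℓ).V) :
    (road w ℓ).Blocks B ↔ ∀ c, IsPath w ℓ ℓ c → ∃ k ≤ ℓ, c k ∈ Bn B k := by
  constructor
  · intro h c hc
    let f : Fin (ℓ+1) → (road w ℓ).V := fun k => mk (k : ℕ) (c k) (hc.1 k (by omega))
    have hne : List.ofFn f ≠ [] := by simp
    have hp1 : List.Chain' (road w ℓ).edge (List.ofFn f) := by
      show List.IsChain _ _
      rw [List.isChain_iff_getElem]
      intro i hi
      simp only [List.length_ofFn] at hi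
      simp only [List.getElem_ofFn]
      exact ⟨rfl, hc.2 i (by omega)⟩
    have hp2 : (road w ℓ).IsSource ((List.ofFn f).head hne) := by
      rw [layer_source, List.head_eq_getElem, List.getElem_ofFn]
      rfl
    have hp3 : (road w ℓ).IsSink ((List.ofFn f).getLast hne) := by
      rw [layer_sink, List.getLast_eq_getElem, List.getElem_ofFn]
      show (List.ofFn f).length - 1 = ℓ
      rw [List.length_ofFn]; rfl
    obtain ⟨v, hv, hvB⟩ := h (List.ofFn f) hne hp1 hp2 hp3
    · rw [List.mem_ofFn] at hv
      obtain ⟨k, rfl⟩ := hv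
      exact ⟨k, by omega, (mem_Bn B (f k)).2 hvB⟩
  · intro h p hp hch hso hsi
    have hch : List.IsChain (road w ℓ).edge p := hch
    rw [List.isChain_iff_getElem] at hch
    have hlen : 0 < p.length := List.length_pos_iff.2 hp
    rw [layer_source, List.head_eq_getElem] at hso
    rw [layer_sink, List.getLast_eq_getElem] at hsi
    have hlay : ∀ k (hk : k < p.length), ((p[k]).1.1 : ℕ) = k := by
      intro k
      induction k with
      | zero => intro _; exact hso
      | succ k ih =>
        intro hk
        have := (hch k hk).1
        rw [ih (by omega)] at this
        exact this
    have hl : p.length = ℓ + 1 := by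
      rw [hlay] at hsi; omega
    have hpath : IsPath w ℓ ℓ (fun k => if hk : k < p.length then ((p[k]).1.2 : ℕ) else 0) := by
      constructor
      · intro k hk
        have hk' : k < p.length := by omega
        simp only [hk', dif_pos]
        have := memL_of p[k]
        rwa [hlay k hk'] at this
      · intro k hk
        have hk' : k < p.length := by omega
        have hk2 : k + 1 < p.length := by omega
        simp only [hk', hk2, dif_pos]
        exact (hch k hk2).2
    obtain ⟨k, hk, hkB⟩ := h _ hpath
    · have hk' : k < p.length := by omega
      simp only [hk', dif_pos] at hkB
      refine ⟨p[k], List.getElem_mem _, (mem_Bn B _).1 ?_⟩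
      rw [hlay k hk']; exact hkB

lemma min_path {w ℓ : ℕ} (B : Set (road w ℓ).V) (hB : (road w ℓ).MinBlocking B)
    (v : (road w ℓ).V) (hv : v ∈ B) :
    ∃ c, IsPath w ℓ ℓ c ∧ c (v.1.1 : ℕ) ∈ Bn B (v.1.1 : ℕ) ∧
      ∀ k ≤ ℓ, k ≠ (v.1.1 : ℕ) → c k ∉ Bn B k := by
  have h1 := hB.2 (B \ {v}) ⟨Set.sdiff_subset, fun h => (h hv).2 rfl⟩
  rw [blocks_iff] at h1
  push Not at h1
  obtain ⟨c, hc, hcn⟩ := h1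
  have hne : ∀ k ≤ ℓ, c k ∈ Bn B k → k = (v.1.1 : ℕ) := by
    intro k hk hkB
    by_contra hn
    apply hcn k hk
    have h2 := (mem_Bn B (mk k (c k) (hc.1 k hk))).1 hkB
    refine (mem_Bn (B \ {v}) (mk k (c k) (hc.1 k hk))).2 ⟨h2, ?_⟩
    intro h3
    apply hn
    rw [← Set.mem_singleton_iff.1 h3]; rfl
  obtain ⟨k, hk, hkB⟩ := (blocks_iff B).1 hB.1 c hc
  refine ⟨c, hc, ?_, fun k hk hkn h => hkn (hne k hk h)⟩
  rw [← hne k hk hkB]; exact hkB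

lemma U_top {w ℓ : ℕ} (B : Set (road w ℓ).V) (hB : (road w ℓ).Blocks B) : U B ℓ = ∅ := by
  by_contra hn
  obtain ⟨j, hj⟩ := Finset.nonempty_iff_ne_empty.2 hn
  obtain ⟨c, hc, _, hcB⟩ := U_path B ℓ j hj
  obtain ⟨k, hk, hkB⟩ := (blocks_iff B).1 hB c hc
  exact hcB k hk hkB

end RoadAux

open RoadAux in

/-- A minimal blocking set of a road spreading over `d` layers has at least `d + q - 1`
vertices, where `q` is the width of the topmost layer it meets
(Lemma `lem:pike-separator-is-large`). -/
theorem road_separator_is_large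
    (w ℓ : ℕ) (hw : 1 ≤ w) (hℓ : w - 1 ≤ ℓ) (B : Set (road w ℓ).V)
    (hB : (road w ℓ).MinBlocking B) (a b d q : ℕ)
    (ha : ∃ v ∈ B, ((v : (road w ℓ).V).1.1 : ℕ) = a)
    (hb : ∃ v ∈ B, ((v : (road w ℓ).V).1.1 : ℕ) = b)
    (hbetween : ∀ v ∈ B,
      a ≤ ((v : (road w ℓ).V).1.1 : ℕ) ∧ ((v : (road w ℓ).V).1.1 : ℕ) ≤ b)
    (hd : d = b - a + 1) (hq : q = min w (ℓ - b + 1)) :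
    d + q - 1 ≤ B.ncard := by
  classical
  obtain ⟨va, hva, hvaa⟩ := ha
  obtain ⟨vb, hvb, hvbb⟩ := hb
  have hbl : b ≤ ℓ := by have := vb.1.1.2; omega
  have hab : a ≤ b := by have := hbetween va hva; omega
  have hBnil : ∀ k, (k < a ∨ b < k) → Bn B k = ∅ := by
    intro k hk
    rw [Finset.eq_empty_iff_forall_notMem]
    intro j hj
    obtain ⟨_, v, hv, h1, _⟩ := Finset.mem_filter.1 hj
    have := hbetween v hv
    omega
  have hUtop := U_top B hB.1
  -- layers above b
  have hUb : U B b = ∅ := by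
    by_contra hn
    have key : ∀ k, b + k ≤ ℓ → (U B (b+k)).Nonempty := by
      intro k
      induction k with
      | zero => intro _; exact Finset.nonempty_iff_ne_empty.2 hn
      | succ k ih =>
        intro hk
        obtain ⟨j, hj⟩ := ih (by omega)
        have hjL := mem_L.1 (U_sub B _ hj)
        by_cases hc : b + k + 1 + j ≤ ℓ
        · refine ⟨j, (U_succ B (b+k) j).2 ⟨⟨mem_L.2 ⟨hjL.1, hc⟩, Or.inl hj⟩, ?_⟩⟩
          rw [hBnil _ (by omega)]; simp
        · refine ⟨j-1, (U_succ B (b+k) (j-1)).2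
            ⟨⟨mem_L.2 ⟨by omega, by omega⟩, Or.inr ?_⟩, ?_⟩⟩
          · rw [show j - 1 + 1 = j by omega, Nat.mod_eq_of_lt hjL.1]; exact hj
          · rw [hBnil _ (by omega)]; simp
    have := key (ℓ - b) (by omega)
    rw [show b + (ℓ - b) = ℓ by omega, hUtop] at this
    simp at this
  have hUne : ∀ i < b, (U B i).Nonempty := by
    obtain ⟨c, hc, -, hcn⟩ := min_path B hB vb hvb
    rw [hvbb] at hcn
    intro i hi
    refine ⟨c i, ?_⟩
    induction i with
    | zero => exact Finset.mem_sdiff.2 ⟨hc.1 0 (by omega), hcn 0 (by omega) (by omega)⟩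
    | succ i ih =>
      exact path_U_step B c hc i (by omega) (ih (by omega)) (hcn _ (by omega) (by omega))
  have hUpr : ∀ i, a ≤ i → i < b → U B i ≠ L w ℓ i := by
    obtain ⟨c, hc, hca, hcn⟩ := min_path B hB va hva
    rw [hvaa] at hcn hca
    intro i hai hib heq
    have key : ∀ k, i + k ≤ ℓ → c (i+k) ∈ U B (i+k) := by
      intro k
      induction k with
      | zero => intro h; rw [Nat.add_zero, heq]; exact hc.1 i h
      | succ k ih =>
        intro h
        exact path_U_step B c hc (i+k) (by omega) (ih (by omega)) (hcn _ h (by omega))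
    have := key (ℓ - i) (by omega)
    rw [show i + (ℓ - i) = ℓ by omega, hUtop] at this
    simp at this
  have hbase : ∀ k ≤ a, L w ℓ k ⊆ Bn B k ∪ U B k := by
    intro k
    induction k with
    | zero =>
      intro _ j hj
      by_cases h : j ∈ Bn B 0
      · exact Finset.mem_union_left _ h
      · exact Finset.mem_union_right _ (Finset.mem_sdiff.2 ⟨hj, h⟩)
    | succ k ih =>
      intro hk j hj
      by_cases h : j ∈ Bn B (k+1)
      · exact Finset.mem_union_left _ h
      · refine Finset.mem_union_right _ ((U_succ B k j).2 ⟨⟨hj, Or.inl ?_⟩, h⟩)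
        have hj' := mem_L.1 hj
        have := ih (by omega) (mem_L.2 ⟨hj'.1, by omega⟩ : j ∈ L w ℓ k)
        rwa [hBnil k (by omega), Finset.empty_union] at this
  have hmain : ∀ k, a + k ≤ b → (L w ℓ (a+k)).card + k ≤
      (∑ i ∈ Finset.range (a+k+1), (Bn B i).card) + (U B (a+k)).card := by
    intro k
    induction k with
    | zero =>
      intro _
      have h1 := (Finset.card_le_card (hbase a le_rfl)).trans (Finset.card_union_le _ _)
      rw [Finset.sum_range_succ]
      simp only [Nat.add_zero]
      omega
    | succ k ih =>
      intro hk
      have h1 := ih (by omega)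
      have h2 := expand w ℓ (a+k) (by omega) (U B (a+k)) (U_sub B _) (hUne _ (by omega))
        (hUpr _ (by omega) (by omega))
      have h3 : (N w ℓ (a+k) (U B (a+k))).card ≤ (Bn B (a+k+1)).card + (U B (a+k+1)).card := by
        have : N w ℓ (a+k) (U B (a+k)) ⊆ Bn B (a+k+1) ∪ U B (a+k+1) := by
          intro j hj
          by_cases h : j ∈ Bn B (a+k+1)
          · exact Finset.mem_union_left _ h
          · exact Finset.mem_union_right _ (Finset.mem_sdiff.2 ⟨hj, h⟩)
        exact (Finset.card_le_card this).trans (Finset.card_union_le _ _)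
      rw [Finset.sum_range_succ]
      rw [← Nat.add_assoc a k 1]
      omega
  have hfin := hmain (b - a) (by omega)
  rw [show a + (b - a) = b by omega, hUb, L_eq w ℓ b hbl, Finset.card_range,
    Finset.card_empty] at hfin
  have hcard : ∑ i ∈ Finset.range (b+1), (Bn B i).card ≤ B.ncard := by
    rw [Set.ncard_eq_toFinset_card' B]
    rw [Finset.card_eq_sum_card_fiberwise (s := B.toFinset) (t := Finset.range (b+1))
      (f := fun v : (road w ℓ).V => (v.1.1 : ℕ))]
    · refine Finset.sum_le_sum fun i _ => ?_
      have : Bn B i ⊆ (B.toFinset.filter fun v : (road w ℓ).V => (v.1.1 : ℕ) = i).image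
          fun v => (v.1.2 : ℕ) := by
        intro j hj
        obtain ⟨_, v, hv, h1, h2⟩ := Finset.mem_filter.1 hj
        exact Finset.mem_image.2 ⟨v, Finset.mem_filter.2 ⟨Set.mem_toFinset.2 hv, h1⟩, h2⟩
      exact (Finset.card_le_card this).trans Finset.card_image_le
    · intro v hv
      have := hbetween v (Set.mem_toFinset.1 hv)
      simp only [Finset.coe_range, Set.mem_Iio]
      omega
  omega
end

section
/- For all integers w ≥ 1 and ℓ ≥ w, the persistent pebbling price of the road of width w and length ℓ is at least (w/2)·log₂(ℓ/w). -/
/-! ## Helper material: pebblings on a width-`w` cylinder `ℕ × ZMod w` -/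

namespace RoadAux

open Finset

/-- number of pebbles on a layer -/
def lay {w : ℕ} [NeZero w] (A : Finset (ℕ × ZMod w)) (i : ℕ) : ℕ :=
  (univ.filter fun c : ZMod w => (i, c) ∈ A).card

/-- number of pebbles on the layers `a, …, a+n-1` -/
def cnt {w : ℕ} [NeZero w] (A : Finset (ℕ × ZMod w)) (a n : ℕ) : ℕ :=
  ∑ i ∈ range n, lay A (a + i)

/-- `Op A a n c`: there is a pebble-free path from layer `a` to `(a+n, c)`. -/
def Op {w : ℕ} (A : Finset (ℕ × ZMod w)) (a : ℕ) : ℕ → ZMod w → Prop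
  | 0, c => (a, c) ∉ A
  | (n+1), c => (a + n + 1, c) ∉ A ∧ (Op A a n c ∨ Op A a n (c+1))

def Good {w : ℕ} (P : ℕ → Finset (ℕ × ZMod w)) (lo hi : ℕ) : Prop :=
  ∀ t, lo ≤ t → t < hi → ∀ i c, ((i+1,c) ∈ P t ↔ (i+1,c) ∈ P (t+1)) ∨
    (((i,c) ∈ P t ∧ (i,c+1) ∈ P t) ∧ ((i,c) ∈ P (t+1) ∧ (i,c+1) ∈ P (t+1)))

variable {w : ℕ} [NeZero w]

lemma Op.not_mem {A : Finset (ℕ × ZMod w)} {a n : ℕ} {c : ZMod w} (h : Op A a n c) :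
    (a + n, c) ∉ A := by
  cases n with
  | zero => exact h
  | succ n => exact h.1

lemma Op.shift {A : Finset (ℕ × ZMod w)} {a m : ℕ} : ∀ {n : ℕ} {c : ZMod w},
    Op A a (m + n) c → Op A (a + m) n c := by
  intro n
  induction n with
  | zero => intro c h; exact h.not_mem
  | succ n ih =>
    intro c h
    refine ⟨?_, ?_⟩
    · have := h.not_mem
      rwa [show a + m + n + 1 = a + (m + (n+1)) by omega]
    · rcases h.2 with h | h
      · exact Or.inl (ih h)
      · exact Or.inr (ih h)

lemma Op_of_column {A : Finset (ℕ × ZMod w)} {a : ℕ} {c : ZMod w} : ∀ n,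
    (∀ i < n + 1, (a + i, c) ∉ A) → Op A a n c := by
  intro n
  induction n with
  | zero => intro h; exact h 0 (by omega)
  | succ n ih =>
    intro h
    exact ⟨h (n+1) (by omega), Or.inl (ih fun i hi => h i (by omega))⟩

lemma cnt_add (A : Finset (ℕ × ZMod w)) (a m n : ℕ) :
    cnt A a (m + n) = cnt A a m + cnt A (a + m) n := by
  unfold cnt
  rw [Finset.sum_range_add]
  simp [add_assoc]

lemma cnt_one (A : Finset (ℕ × ZMod w)) (a : ℕ) : cnt A a 1 = lay A a := by
  simp [cnt]

lemma cnt_le_card (A : Finset (ℕ × ZMod w)) (a n : ℕ) : cnt A a n ≤ A.card := by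
  have key : cnt A a n ≤ (A.filter fun v => v.1 < a + n).card := by
    induction n with
    | zero => simp [cnt]
    | succ n ih =>
      rw [cnt_add, cnt_one]
      have h1 : lay A (a+n) ≤ (A.filter fun v => v.1 = a + n).card := by
        unfold lay
        apply Finset.card_le_card_of_injOn (fun c => (a+n, c))
        · intro c hc
          simpa using hc
        · intro c _ d _ h
          simpa using h
      have h2 : (A.filter fun v => v.1 < a + n).card + (A.filter fun v => v.1 = a + n).card
          ≤ (A.filter fun v => v.1 < a + (n+1)).card := by
        rw [← Finset.card_union_of_disjoint]
        · apply Finset.card_le_card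
          intro v hv
          simp only [mem_union, mem_filter] at hv ⊢
          rcases hv with hv | hv
          · exact ⟨hv.1, by omega⟩
          · exact ⟨hv.1, by omega⟩
        · rw [Finset.disjoint_filter]
          intro v _ h1 h2
          omega
      omega
  exact key.trans (Finset.card_filter_le _ _)

lemma clean_columns (A : Finset (ℕ × ZMod w)) (a n : ℕ) :
    w ≤ (univ.filter fun c : ZMod w => ∀ i < n, (a + i, c) ∉ A).card + cnt A a n := by
  induction n with
  | zero => simp [cnt, ZMod.card]
  | succ n ih =>
    rw [cnt_add, cnt_one]
    have : (univ.filter fun c : ZMod w => ∀ i < n, (a + i, c) ∉ A).card ≤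
        (univ.filter fun c : ZMod w => ∀ i < n + 1, (a + i, c) ∉ A).card + lay A (a+n) := by
      unfold lay
      refine le_trans (Finset.card_le_card ?_) (Finset.card_union_le _ _)
      intro c hc
      simp only [mem_union, mem_filter, mem_univ, true_and] at hc ⊢
      by_cases h : (a+n, c) ∈ A
      · exact Or.inr h
      · left
        intro i hi
        rcases Nat.lt_succ_iff_lt_or_eq.mp hi with h1 | h1
        · exact hc i h1
        · rw [h1]; exact h
    omega

lemma card_pred (X : Finset (ZMod w)) (hne : X.Nonempty) :
    min w (X.card + 1) ≤ (X ∪ X.image (· + 1)).card := by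
  by_contra hcon
  have hsub : X ⊆ X ∪ X.image (· + 1) := subset_union_left
  have hle := Finset.card_le_card hsub
  have heq : X = X ∪ X.image (· + 1) := Finset.eq_of_subset_of_card_le hsub (by omega)
  have hcl : ∀ x ∈ X, x + 1 ∈ X := by
    intro x hx
    rw [heq]
    exact mem_union_right _ (mem_image_of_mem _ hx)
  obtain ⟨x, hx⟩ := hne
  have hall : ∀ n : ℕ, x + n ∈ X := by
    intro n
    induction n with
    | zero => simpa using hx
    | succ n ih =>
      have := hcl _ ih
      push_cast
      rwa [← add_assoc]
  have huniv : X = univ := by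
    ext c
    simp only [mem_univ, iff_true]
    have := hall (c - x).val
    rw [ZMod.natCast_zmod_val] at this
    simpa using this
  have : X.card = w := by rw [huniv, Finset.card_univ, ZMod.card]
  omega

open Classical in
lemma grow (A : Finset (ℕ × ZMod w)) (a n : ℕ) (T : ℕ → ZMod w → Prop)
    (hstep : ∀ m < n, ∀ c, (a + m + 1, c) ∉ A → T (m+1) c → T m c ∧ T m (c+1))
    (htop : ∃ c, T n c)
    (hne : ∀ m ≤ n, n + 2 ≤ m + w → ∃ c, T m c ∧ (a + m, c) ∉ A)
    (hn : w ≤ n + 1) :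
    w ≤ (univ.filter fun c : ZMod w => T 0 c ∧ (a, c) ∉ A).card + cnt A a (n+1) := by
  have key : ∀ j m, m + j = n → min w (j+1) ≤
      (univ.filter fun c : ZMod w => T m c ∧ (a + m, c) ∉ A).card + cnt A (a+m) (j+1) := by
    intro j
    induction j with
    | zero =>
      intro m hm
      obtain rfl : m = n := by omega
      obtain ⟨c, hc⟩ := htop
      have : 0 < (univ.filter fun c : ZMod w => T m c ∧ (a + m, c) ∉ A).card + cnt A (a+m) 1 := by
        rw [cnt_one]
        by_cases h : (a+m, c) ∈ A
        · have : 0 < lay A (a+m) := Finset.card_pos.mpr ⟨c, by simpa using h⟩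
          omega
        · have : 0 < (univ.filter fun c : ZMod w => T m c ∧ (a + m, c) ∉ A).card :=
            Finset.card_pos.mpr ⟨c, by simp [hc, h]⟩
          omega
      simp only [Nat.zero_add]
      omega
    | succ j ih =>
      intro m hm
      have ih' := ih (m+1) (by omega)
      have hc : cnt A (a+m) (j+1+1) = lay A (a+m) + cnt A (a+(m+1)) (j+1) := by
        rw [show j+1+1 = 1 + (j+1) by omega, cnt_add, cnt_one, add_assoc a m 1]
      rw [hc]
      set X := univ.filter fun c : ZMod w => T (m+1) c ∧ (a + (m+1), c) ∉ A with hX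
      have hp : (X ∪ X.image (· + 1)).card ≤
          (univ.filter fun c : ZMod w => T m c ∧ (a + m, c) ∉ A).card + lay A (a+m) := by
        unfold lay
        refine le_trans (Finset.card_le_card ?_) (Finset.card_union_le _ _)
        intro c hc
        have hT : T m c := by
          simp only [mem_union, mem_image] at hc
          rcases hc with hc | ⟨d, hd, rfl⟩
          · simp only [hX, mem_filter, mem_univ, true_and] at hc
            exact (hstep m (by omega) c hc.2 hc.1).1
          · simp only [hX, mem_filter, mem_univ, true_and] at hd
            exact (hstep m (by omega) d hd.2 hd.1).2
        simp only [mem_union, mem_filter, mem_univ, true_and]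
        by_cases h : (a+m, c) ∈ A
        · exact Or.inr h
        · exact Or.inl ⟨hT, h⟩
      by_cases hX0 : X.Nonempty
      · have := card_pred X hX0
        omega
      · have hX1 : X.card = 0 := by
          rw [Finset.not_nonempty_iff_eq_empty.mp hX0]; rfl
        by_cases hj : n + 2 ≤ (m+1) + w
        · obtain ⟨c, hc⟩ := hne (m+1) (by omega) hj
          exact absurd ⟨c, by simpa [hX] using hc⟩ hX0
        · omega
  have := key n 0 (by omega)
  simp only [add_zero] at this
  omega

lemma closed_lemma (A B : Finset (ℕ × ZMod w)) (a n : ℕ) (z : ZMod w)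
    (hA : Op A a n z) (hB : ¬ Op B a n z) (hc : cnt B a (n+1) < w) (hn : w ≤ n + 1) :
    ∃ m ≤ n, n + 2 ≤ m + w ∧ ∃ c, Op A a m c ∧ (a + m, c) ∈ B := by
  classical
  by_contra hcon
  push Not at hcon
  have hd : ∀ j m, m + j = n → n + 2 ≤ m + w → ∃ c, Op A a m c ∧ ¬ Op B a m c := by
    intro j
    induction j with
    | zero => intro m hm _; obtain rfl : m = n := by omega
              exact ⟨z, hA, hB⟩
    | succ j ih =>
      intro m hm hw
      obtain ⟨c, h1, h2⟩ := ih (m+1) (by omega) (by omega)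
      have h3 := hcon (m+1) (by omega) (by omega) c h1
      have h4 : ¬ (Op B a m c ∨ Op B a m (c+1)) := fun h => h2 ⟨h3, h⟩
      push Not at h4
      rcases h1.2 with h | h
      · exact ⟨c, h, h4.1⟩
      · exact ⟨c+1, h, h4.2⟩
  have := grow B a n (fun m c => ¬ Op B a m c) ?_ ⟨z, hB⟩ ?_ hn
  · have h0 : (univ.filter fun c : ZMod w => ¬ Op B a 0 c ∧ (a, c) ∉ B).card = 0 := by
      rw [Finset.card_eq_zero, Finset.filter_eq_empty_iff]
      rintro c _ ⟨h1, h2⟩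
      exact h1 h2
    have h5 : (univ.filter fun c : ZMod w => ¬ Op B a 0 c ∧ (a, c) ∉ B).card + cnt B a (n+1) < w := by
      omega
    have h6 := lt_of_le_of_lt this (lt_of_eq_of_lt (by congr!) h5)
    exact lt_irrefl _ h6
  · intro m _ c hc hT
    constructor
    · intro h; exact hT ⟨hc, Or.inl h⟩
    · intro h; exact hT ⟨hc, Or.inr h⟩
  · intro m hm hw
    obtain ⟨c, h1, h2⟩ := hd (n-m) m (by omega) hw
    exact ⟨c, h2, hcon m hm hw c h1⟩

/-- descending along an open path of touched vertices -/
lemma descend (A : Finset (ℕ × ZMod w)) (a : ℕ) (T : ℕ → ZMod w → Prop)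
    (hstep : ∀ m c, (a + m + 1, c) ∉ A → T (m+1) c → T m c ∧ T m (c+1)) :
    ∀ j m c, Op A a (m + j) c → T (m+j) c → ∃ d, Op A a m d ∧ T m d := by
  intro j
  induction j with
  | zero => intro m c h1 h2; exact ⟨c, h1, h2⟩
  | succ j ih =>
    intro m c h1 h2
    obtain ⟨h3, h4⟩ := hstep (m+j) c h1.not_mem h2
    rcases h1.2 with h | h
    · exact ih m c h h3
    · exact ih m _ h h4

/-- A vertex that is unpebbled at time `t` and pebbled at time `t'` has been placed in between. -/
lemma exists_place (P : ℕ → Finset (ℕ × ZMod w)) (v : ℕ × ZMod w) (t t' : ℕ) (h : t ≤ t')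
    (h1 : v ∉ P t) (h2 : v ∈ P t') : ∃ s, t ≤ s ∧ s < t' ∧ v ∉ P s ∧ v ∈ P (s+1) := by
  induction t', h using Nat.le_induction with
  | base => exact absurd h2 h1
  | succ n hn ih =>
    by_cases hv : v ∈ P n
    · obtain ⟨s, a, b, c⟩ := ih hv
      exact ⟨s, a, by omega, c⟩
    · exact ⟨n, hn, by omega, hv, h2⟩

lemma Good.place {P : ℕ → Finset (ℕ × ZMod w)} {lo hi : ℕ} (hG : Good P lo hi)
    {t t' : ℕ} (h : t ≤ t') (hlo : lo ≤ t) (hhi : t' ≤ hi) {i : ℕ} {c : ZMod w}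
    (h1 : (i+1, c) ∉ P t) (h2 : (i+1, c) ∈ P t') : ∃ s, t ≤ s ∧ s < t' ∧
    (((i,c) ∈ P s ∧ (i,c+1) ∈ P s) ∧ ((i,c) ∈ P (s+1) ∧ (i,c+1) ∈ P (s+1))) := by
  obtain ⟨s, a, b, c1, d⟩ := exists_place P _ t t' h h1 h2
  refine ⟨s, a, b, ?_⟩
  rcases hG s (by omega) (by omega) i c with h | h
  · exact absurd (h.mpr d) c1
  · exact h

lemma Good.mono {P : ℕ → Finset (ℕ × ZMod w)} {lo hi lo' hi' : ℕ} (hG : Good P lo hi)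
    (h1 : lo ≤ lo') (h2 : hi' ≤ hi) : Good P lo' hi' :=
  fun t a b => hG t (by omega) (by omega)

lemma Good.reverse {P : ℕ → Finset (ℕ × ZMod w)} {lo hi : ℕ} (hG : Good P lo hi) :
    Good (fun s => P (hi - s)) 0 (hi - lo) := by
  intro t _ h2 i c
  have := hG (hi - (t+1)) (by omega) (by omega) i c
  rw [show hi - (t+1) + 1 = hi - t by omega] at this
  rcases this with h | h
  · exact Or.inl h.symm
  · exact Or.inr ⟨h.2, h.1⟩

/-- An open vertex above the bottom layer is not pebbled after a single step. -/
lemma Good.one_step {P : ℕ → Finset (ℕ × ZMod w)} {lo hi : ℕ} (hG : Good P lo hi)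
    {t : ℕ} (hlo : lo ≤ t) (hhi : t < hi) {a m : ℕ} {c : ZMod w} (hm : 1 ≤ m)
    (h1 : Op (P t) a m c) (h2 : (a + m, c) ∈ P (t+1)) : False := by
  obtain ⟨m, rfl⟩ : ∃ k, m = k + 1 := ⟨m - 1, by omega⟩
  rcases hG t hlo hhi (a+m) c with h | h
  · exact h1.not_mem (h.mpr h2)
  · rcases h1.2 with h3 | h3
    · exact h3.not_mem h.1.1
    · exact h3.not_mem h.1.2

/-- the last time with a property -/
lemma exists_last (p : ℕ → Prop) (lo hi : ℕ) (h : lo ≤ hi) (h1 : p lo) :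
    ∃ t, lo ≤ t ∧ t ≤ hi ∧ p t ∧ ∀ s, t < s → s ≤ hi → ¬ p s := by
  induction hi, h using Nat.le_induction with
  | base => exact ⟨lo, le_refl _, le_refl _, h1, fun s a b => by omega⟩
  | succ n hn ih =>
    by_cases hp : p (n+1)
    · exact ⟨n+1, by omega, le_refl _, hp, fun s a b => by omega⟩
    · obtain ⟨t, a, b, c, d⟩ := ih
      refine ⟨t, a, by omega, c, fun s e f => ?_⟩
      rcases Nat.lt_or_ge n s with h | h
      · obtain rfl : s = n + 1 := by omega
        exact hp
      · exact d s e h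

/-- heights -/
def NN (w : ℕ) : ℕ → ℕ
  | 0 => w
  | (k+1) => 2 * NN w k + w

lemma NN_eq (w k : ℕ) : NN w k + w = 2 ^ (k+1) * w := by
  induction k with
  | zero => simp [NN]; ring
  | succ k ih =>
    have : NN w (k+1) = 2 * NN w k + w := rfl
    rw [this, pow_succ]
    linarith

lemma NN_ge (w k : ℕ) : w ≤ NN w k := by
  cases k with
  | zero => exact le_refl _
  | succ k => simp [NN]

def Claim (w : ℕ) [NeZero w] (k : ℕ) : Prop :=
  ∀ (P : ℕ → Finset (ℕ × ZMod w)) (lo hi a : ℕ) (c : ZMod w), lo ≤ hi → Good P lo hi →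
    Op (P lo) a (NN w k - 1) c → 2 * cnt (P lo) a (NN w k) < w →
    (a + (NN w k - 1), c) ∈ P hi → ∃ t, lo ≤ t ∧ t ≤ hi ∧ (k + 2) * w ≤ 2 * cnt (P t) a (NN w k)

lemma Claim.sym {k : ℕ} (h : Claim w k) (P : ℕ → Finset (ℕ × ZMod w)) (lo hi a : ℕ) (c : ZMod w)
    (hG : Good P lo hi) (t0 t1 : ℕ) (h0 : lo ≤ t0) (h0' : t0 ≤ hi) (h1 : lo ≤ t1) (h1' : t1 ≤ hi)
    (hop : Op (P t0) a (NN w k - 1) c) (hl : 2 * cnt (P t0) a (NN w k) < w)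
    (hp : (a + (NN w k - 1), c) ∈ P t1) :
    ∃ t, lo ≤ t ∧ t ≤ hi ∧ (k + 2) * w ≤ 2 * cnt (P t) a (NN w k) := by
  rcases le_total t0 t1 with hle | hle
  · obtain ⟨t, a1, a2, a3⟩ := h P t0 t1 a c hle (hG.mono h0 h1') hop hl hp
    exact ⟨t, by omega, by omega, a3⟩
  · have hG' := (hG.mono h1 h0').reverse
    obtain ⟨t, a1, a2, a3⟩ := h (fun s => P (t0 - s)) 0 (t0 - t1) a c (by omega) hG'
      (by simpa using hop) (by simpa using hl) (by
        simpa [show t0 - (t0 - t1) = t1 by omega] using hp)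
    exact ⟨t0 - t, by omega, by omega, a3⟩

lemma w_pos (w : ℕ) [NeZero w] : 0 < w := Nat.pos_of_ne_zero (NeZero.ne w)

lemma claim_zero : Claim w 0 := by
  intro P lo hi a c hle hG hop hl hp
  have hw := w_pos w
  simp only [NN] at *
  by_contra hcon
  push Not at hcon
  obtain ⟨t, h1, h2, h3, h4⟩ := exists_last (fun t => Op (P t) a (w-1) c) lo hi hle hop
  have hne : t ≠ hi := by
    rintro rfl
    exact h3.not_mem hp
  have h5 := h4 (t+1) (by omega) (by omega)
  have h6 := hcon (t+1) (by omega) (by omega)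
  obtain ⟨m, m1, m2, d, d1, d2⟩ := closed_lemma (P t) (P (t+1)) a (w-1) c h3 h5
    (by rw [show w - 1 + 1 = w by omega]; omega) (by omega)
  exact hG.one_step h1 (by omega) (by omega) d1 d2

lemma claim_succ (k : ℕ) (ih : Claim w k) : Claim w (k+1) := by
  classical
  intro P lo hi a c hle hG hop hl hp
  have hw := w_pos w
  have hN := NN_ge w k
  have hNs : NN w (k+1) = 2 * NN w k + w := rfl
  rw [hNs] at hop hl hp ⊢
  generalize hNdef : NN w k = N at *
  have hsplit : ∀ s, cnt (P s) a (2 * N + w) = cnt (P s) a N + cnt (P s) (a+N) (N+w) := by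
    intro s
    rw [← cnt_add]; congr 1; omega
  have hsplit2 : ∀ s, cnt (P s) (a+N) (N+w) = cnt (P s) (a+N) N + cnt (P s) (a+N+N) w := by
    intro s
    rw [← cnt_add]
  have hop' : Op (P lo) (a+N) (N+w-1) c := by
    apply Op.shift
    rwa [show N + (N+w-1) = 2*N+w-1 by omega]
  have hp' : (a + N + (N+w-1), c) ∈ P hi := by
    rwa [show a + N + (N+w-1) = a + (2*N+w-1) by omega]
  obtain ⟨t, t1, t2, ⟨t3, t3'⟩, t4⟩ := exists_last
    (fun t => Op (P t) (a+N) (N+w-1) c ∧ 2 * cnt (P t) (a+N) (N+w) < w) lo hi hle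
    ⟨hop', by have := hsplit lo; omega⟩
  have hne : t ≠ hi := by
    rintro rfl
    exact t3.not_mem hp'
  have hex : ∃ u, t < u ∧ (2 * cnt (P u) (a+N) (N+w) < w ∨ u = hi) := ⟨hi, by omega, Or.inr rfl⟩
  obtain ⟨u1, u2⟩ := Nat.find_spec hex
  have hmin : ∀ s, t < s → s < Nat.find hex → w ≤ 2 * cnt (P s) (a+N) (N+w) := by
    intro s hs1 hs2
    have := Nat.find_min hex hs2
    push Not at this
    exact (this hs1).1
  have huhi : Nat.find hex ≤ hi := Nat.find_min' hex ⟨by omega, Or.inr rfl⟩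
  generalize Nat.find hex = u at *
  have hv : ∃ m d, N ≤ m ∧ Op (P t) (a+N) m d ∧ (a+N+m, d) ∈ P u := by
    by_cases hlu : 2 * cnt (P u) (a+N) (N+w) < w
    · have hno : ¬ Op (P u) (a+N) (N+w-1) c := fun h => t4 u u1 huhi ⟨h, hlu⟩
      obtain ⟨m, m1, m2, d, d1, d2⟩ := closed_lemma (P t) (P u) (a+N) (N+w-1) c t3 hno
        (by rw [show N + w - 1 + 1 = N + w by omega]; omega) (by omega)
      exact ⟨m, d, by omega, d1, d2⟩
    · have : u = hi := by
        rcases u2 with h | h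
        · exact absurd h hlu
        · exact h
      subst this
      exact ⟨N+w-1, c, by omega, t3, hp'⟩
  obtain ⟨m, d, hm, hd1, hd2⟩ := hv
  have htu : t + 1 < u := by
    by_contra h
    obtain rfl : u = t + 1 := by omega
    exact hG.one_step t1 (by omega) (by omega) hd1 hd2
  let T : ℕ → ZMod w → Prop := fun i e => ∃ s, t < s ∧ s < u ∧ (i, e) ∈ P s
  have hT0 : ∀ i e, (i+1, e) ∉ P t → (i+1, e) ∈ P u → T i e ∧ T i (e+1) := by
    intro i e h1 h2
    obtain ⟨s, s1, s2, s3, s4⟩ := hG.place (le_of_lt u1) t1 huhi h1 h2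
    rcases Nat.eq_or_lt_of_le s1 with h | h
    · exact ⟨⟨s+1, by omega, by omega, s4.1⟩, ⟨s+1, by omega, by omega, s4.2⟩⟩
    · exact ⟨⟨s, by omega, by omega, s3.1⟩, ⟨s, by omega, by omega, s3.2⟩⟩
  have hT : ∀ i e, (i+1, e) ∉ P t → T (i+1) e → T i e ∧ T i (e+1) := by
    rintro i e h1 ⟨s', h2, h2', h3⟩
    obtain ⟨s, s1, s2, s3, s4⟩ := hG.place (le_of_lt h2) t1 (by omega) h1 h3
    exact ⟨⟨s+1, by omega, by omega, s4.1⟩, ⟨s+1, by omega, by omega, s4.2⟩⟩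
  have hstart : ∃ d', Op (P t) (a+N) (m-1) d' ∧ T (a+N+(m-1)) d' := by
    obtain ⟨m', rfl⟩ : ∃ m', m = m' + 1 := ⟨m-1, by omega⟩
    obtain ⟨h1, h2⟩ := hT0 (a+N+m') d hd1.not_mem hd2
    simp only [Nat.add_sub_cancel]
    rcases hd1.2 with h | h
    · exact ⟨_, h, h1⟩
    · exact ⟨_, h, h2⟩
  obtain ⟨d', hd'1, hd'2⟩ := hstart
  have hdesc : ∀ j ≤ N - 1, ∃ e, Op (P t) (a+N) j e ∧ T (a+N+j) e := by
    intro j hj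
    refine descend (P t) (a+N) (fun i e => T (a+N+i) e) (fun i e h1 h2 => hT _ _ h1 h2)
      (m-1-j) j d' ?_ ?_
    · rwa [show j + (m-1-j) = m-1 by omega]
    · rwa [show j + (m-1-j) = m-1 by omega]
  by_cases hcase : ∃ s, t < s ∧ s < u ∧ 2 * cnt (P s) a N < w
  · obtain ⟨s, s1, s2, s3⟩ := hcase
    have hg := grow (P t) (a+N) (N-1) (fun i e => T (a+N+i) e)
      (fun i _ e h1 h2 => hT _ _ h1 h2) (by
        obtain ⟨e, _, he⟩ := hdesc (N-1) (le_refl _)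
        exact ⟨e, he⟩) (by
        intro i hi' _
        obtain ⟨e, he', he⟩ := hdesc i hi'
        exact ⟨e, he, he'.not_mem⟩) (by omega)
    rw [show N - 1 + 1 = N by omega] at hg
    have hcl := clean_columns (P s) a N
    have h2t := hsplit2 t
    set X := univ.filter fun e : ZMod w => T (a+N+0) e ∧ (a+N, e) ∉ P t with hX
    set Y := univ.filter fun e : ZMod w => ∀ i < N, (a + i, e) ∉ P s with hY
    have hXY : (X ∩ Y).Nonempty := by
      by_contra hcon
      rw [Finset.not_nonempty_iff_eq_empty, ← Finset.disjoint_iff_inter_eq_empty] at hcon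
      have h1 := Finset.card_union_of_disjoint hcon
      have h2 : (X ∪ Y).card ≤ w := by
        have := Finset.card_le_univ (X ∪ Y)
        rwa [ZMod.card] at this
      omega
    obtain ⟨e, he⟩ := hXY
    simp only [hX, hY, mem_inter, mem_filter, mem_univ, true_and] at he
    obtain ⟨⟨he1, he2⟩, he3⟩ := he
    have he4 : T (a + (N-1)) e := by
      have hh : a + N = a + (N-1) + 1 := by omega
      rw [hh] at he2
      rw [show a + N + 0 = a + (N-1) + 1 by omega] at he1
      exact (hT _ _ he2 he1).1
    obtain ⟨s', s'1, s'2, s'3⟩ := he4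
    have hopL : Op (P s) a (N-1) e := Op_of_column _ (fun i hi' => he3 i (by omega))
    obtain ⟨r, r1, r2, r3⟩ := Claim.sym ih P (t+1) (u-1) a e (hG.mono (by omega) (by omega)) s s'
      (by omega) (by omega) (by omega) (by omega)
      (by rw [hNdef]; exact hopL) (by rw [hNdef]; exact s3) (by rw [hNdef]; exact s'3)
    rw [hNdef] at r3
    refine ⟨r, by omega, by omega, ?_⟩
    have := hmin r (by omega) (by omega)
    rw [hsplit r]
    nlinarith
  · push Not at hcase
    obtain ⟨e, he1, s', s'1, s'2, s'3⟩ := hdesc (N-1) (le_refl _)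
    have hlt : 2 * cnt (P t) (a+N) N < w := by have := hsplit2 t; omega
    obtain ⟨r, r1, r2, r3⟩ := ih P t s' (a+N) e (by omega) (hG.mono (by omega) (by omega))
      (by rw [hNdef]; exact he1) (by rw [hNdef]; exact hlt) (by rw [hNdef]; exact s'3)
    rw [hNdef] at r3
    have hrt : r ≠ t := by
      rintro rfl
      nlinarith
    have := hcase r (by omega) (by omega)
    refine ⟨r, by omega, by omega, ?_⟩
    rw [hsplit r, hsplit2 r]
    nlinarith

lemma claim_all (k : ℕ) : Claim w k := by
  induction k with
  | zero => exact claim_zero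
  | succ k ih => exact claim_succ k ih

/-! ### Roads -/

def emb (w ℓ : ℕ) (v : (road w ℓ).V) : ℕ × ZMod w := ((v.1.1 : ℕ), ((v.1.2 : ℕ) : ZMod w))

lemma emb_inj (ℓ : ℕ) : Function.Injective (emb w ℓ) := by
  rintro ⟨⟨i, j⟩, h⟩ ⟨⟨i', j'⟩, h'⟩ he
  simp only [emb, Prod.mk.injEq] at he
  obtain ⟨h1, h2⟩ := he
  have h3 : (j : ℕ) = j' := by
    rw [ZMod.natCast_eq_natCast_iff'] at h2
    rwa [Nat.mod_eq_of_lt j.2, Nat.mod_eq_of_lt j'.2] at h2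
  have h4 : i = i' := Fin.ext h1
  have h5 : j = j' := Fin.ext h3
  subst h4 h5
  rfl

lemma preds (ℓ : ℕ) (v : (road w ℓ).V) (i : ℕ) (c : ZMod w) (hv : emb w ℓ v = (i+1, c)) :
    (∃ u, (road w ℓ).edge u v ∧ emb w ℓ u = (i, c)) ∧
    (∃ u, (road w ℓ).edge u v ∧ emb w ℓ u = (i, c+1)) := by
  have hw := w_pos w
  obtain ⟨⟨p, q⟩, h⟩ := v
  simp only [emb, Prod.mk.injEq] at hv
  obtain ⟨h1, h2⟩ := hv
  simp only at h
  have hp := p.2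
  have hq := q.2
  constructor
  · refine ⟨⟨(⟨i, by omega⟩, q), ?_⟩, ?_, ?_⟩
    · simp only; omega
    · exact ⟨h1, Or.inl rfl⟩
    · simp [emb, h2]
  · refine ⟨⟨(⟨i, by omega⟩, ⟨((q:ℕ)+1) % w, Nat.mod_lt _ hw⟩), ?_⟩, ?_, ?_⟩
    · simp only
      have := Nat.mod_le ((q:ℕ)+1) w
      omega
    · exact ⟨h1, Or.inr rfl⟩
    · simp [emb, h2]

lemma good_of_pebbling (ℓ : ℕ) (P : ℕ → Finset (road w ℓ).V) (τ : ℕ)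
    (h : (road w ℓ).IsRevPebbling P τ) :
    Good (fun t => (P t).image (emb w ℓ)) 0 τ := by
  intro t _ ht i c
  have hmem : ∀ s v, emb w ℓ v ∈ (P s).image (emb w ℓ) ↔ v ∈ P s := by
    intro s v
    rw [Finset.mem_image]
    constructor
    · rintro ⟨u, hu, hh⟩
      rwa [← emb_inj ℓ hh]
    · intro hv; exact ⟨v, hv, rfl⟩
  by_cases hex : ∃ v, emb w ℓ v = (i+1, c)
  · obtain ⟨v, hv⟩ := hex
    obtain ⟨⟨u1, e1, f1⟩, ⟨u2, e2, f2⟩⟩ := preds ℓ v i c hv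
    simp only [← hv, ← f1, ← f2, hmem]
    have hne1 : u1 ≠ v := by
      rintro rfl
      rw [f1] at hv
      simp at hv
    have hne2 : u2 ≠ v := by
      rintro rfl
      rw [f2] at hv
      simp at hv
    rcases h.2 t ht with ⟨x, x1, x2, x3⟩ | ⟨x, x1, x2, x3⟩
    · by_cases hx : v = x
      · subst hx
        right
        rw [x3]
        have a1 := x2 u1 e1
        have a2 := x2 u2 e2
        simp [a1, a2]
      · left
        rw [x3]
        simp [hx]
    · by_cases hx : v = x
      · subst hx
        right
        rw [x3]
        have a1 := x2 u1 e1
        have a2 := x2 u2 e2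
        simp [a1, a2, hne1, hne2]
      · left
        rw [x3]
        simp [hx]
  · left
    simp only [Finset.mem_image]
    constructor
    · rintro ⟨v, _, hv⟩; exact absurd ⟨v, hv⟩ hex
    · rintro ⟨v, _, hv⟩; exact absurd ⟨v, hv⟩ hex

lemma Op_empty (a n : ℕ) (c : ZMod w) : Op (∅ : Finset (ℕ × ZMod w)) a n c :=
  Op_of_column n (by simp)

lemma space_bound (ℓ k : ℕ) (hk : NN w k ≤ ℓ + 1) (P : ℕ → Finset (road w ℓ).V) (τ : ℕ)
    (h : (road w ℓ).IsRevPebbling P τ) (hz : P τ = {roadSink w ℓ (w_pos w)}) :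
    (k + 2) * w ≤ 2 * (road w ℓ).space P τ := by
  have hw := w_pos w
  have hN := NN_ge w k
  have hG := good_of_pebbling ℓ P τ h
  obtain ⟨t, _, t2, t3⟩ := claim_all (w := w) k (fun t => (P t).image (emb w ℓ)) 0 τ
    (ℓ + 1 - NN w k) 0 (Nat.zero_le _) hG (by
      simp only [h.1, Finset.image_empty]; exact Op_empty _ _ _) (by
      have := cnt_le_card ((P 0).image (emb w ℓ)) (ℓ + 1 - NN w k) (NN w k)
      simp only [h.1, Finset.image_empty, Finset.card_empty] at this ⊢
      omega) (by
      simp only [hz, Finset.image_singleton, Finset.mem_singleton]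
      simp only [emb, roadSink, Prod.mk.injEq]
      refine ⟨?_, by simp⟩
      simp only [Fin.val_last]
      omega)
  have h1 := cnt_le_card ((P t).image (emb w ℓ)) (ℓ + 1 - NN w k) (NN w k)
  have h2 : ((P t).image (emb w ℓ)).card ≤ (P t).card := Finset.card_image_le
  have h3 : (P t).card ≤ (road w ℓ).space P τ :=
    Finset.le_sup (f := fun t => (P t).card) (Finset.mem_range.mpr (by omega))
  omega

/-! ### Existence of a persistent pebbling -/

def Reach (G : Dgraph) (Q : Finset G.V) : Prop := ∃ P τ, G.IsRevPebbling P τ ∧ P τ = Q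

lemma Reach.empty (G : Dgraph) : Reach G ∅ := ⟨fun _ => ∅, 0, ⟨rfl, by simp⟩, rfl⟩

lemma Reach.step {G : Dgraph} {Q Q' : Finset G.V} (h : Reach G Q) (hs : G.RevStep Q Q') :
    Reach G Q' := by
  obtain ⟨P, τ, ⟨h0, h1⟩, rfl⟩ := h
  refine ⟨fun t => if t ≤ τ then P t else Q', τ + 1, ⟨by simp [h0], ?_⟩, by simp⟩
  intro t ht
  rcases Nat.lt_or_ge t τ with h | h
  · have e1 : t ≤ τ := by omega
    have e2 : t + 1 ≤ τ := by omega
    simp only [e1, e2, if_true]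
    exact h1 t h
  · obtain rfl : t = τ := by omega
    simpa using hs

lemma exists_top {G : Dgraph} (r : G.V → ℕ) (hr : ∀ u v, G.edge u v → r u < r v)
    (D : Finset G.V) (hne : D.Nonempty) (hD : ∀ v ∈ D, ∀ u, G.edge u v → u ∈ D) :
    ∃ v ∈ D, (∀ u, G.edge u v → u ∈ D.erase v) ∧
      (∀ x ∈ D.erase v, ∀ u, G.edge u x → u ∈ D.erase v) := by
  obtain ⟨v, hv, hmax⟩ := Finset.exists_max_image D r hne
  refine ⟨v, hv, ?_, ?_⟩
  · intro u hu
    refine Finset.mem_erase.mpr ⟨?_, hD v hv u hu⟩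
    rintro rfl
    exact lt_irrefl _ (hr _ _ hu)
  · intro x hx u hu
    have hx' := (Finset.mem_erase.mp hx).2
    refine Finset.mem_erase.mpr ⟨?_, hD x hx' u hu⟩
    rintro rfl
    have := hr _ _ hu
    have := hmax x hx'
    omega

lemma reach_down {G : Dgraph} (r : G.V → ℕ) (hr : ∀ u v, G.edge u v → r u < r v) :
    ∀ n (D : Finset G.V), D.card = n → (∀ v ∈ D, ∀ u, G.edge u v → u ∈ D) → Reach G D := by
  intro n
  induction n with
  | zero => intro D hD _; rw [Finset.card_eq_zero.mp hD]; exact Reach.empty G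
  | succ n ih =>
    intro D hc hD
    obtain ⟨v, hv, h1, h2⟩ := exists_top r hr D (Finset.card_pos.mp (by omega)) hD
    have := ih (D.erase v) (by rw [Finset.card_erase_of_mem hv]; omega) h2
    refine this.step (Or.inl ⟨v, by simp, h1, ?_⟩)
    rw [Finset.insert_erase hv]

lemma reach_clear {G : Dgraph} (r : G.V → ℕ) (hr : ∀ u v, G.edge u v → r u < r v) (z : G.V) :
    ∀ n (D : Finset G.V), D.card = n → z ∉ D → (∀ v ∈ D, ∀ u, G.edge u v → u ∈ D) →
      Reach G (insert z D) → Reach G {z} := by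
  intro n
  induction n with
  | zero =>
    intro D hD _ _ h
    rw [Finset.card_eq_zero.mp hD] at h
    simpa using h
  | succ n ih =>
    intro D hc hz hD h
    obtain ⟨v, hv, h1, h2⟩ := exists_top r hr D (Finset.card_pos.mp (by omega)) hD
    have hvz : z ≠ v := by rintro rfl; exact hz hv
    refine ih (D.erase v) (by rw [Finset.card_erase_of_mem hv]; omega)
      (fun hh => hz (Finset.mem_erase.mp hh).2) h2 ?_
    refine h.step (Or.inr ⟨v, Finset.mem_insert_of_mem hv, ?_, ?_⟩)
    · intro u hu
      exact Finset.mem_insert_of_mem (hD v hv u hu)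
    · rw [Finset.erase_insert_of_ne hvz]

lemma reach_sink (ℓ : ℕ) (hw : 0 < w) : Reach (road w ℓ) {roadSink w ℓ hw} := by
  let r : (road w ℓ).V → ℕ := fun v => (v.1.1 : ℕ)
  have hr : ∀ u v, (road w ℓ).edge u v → r u < r v := by
    intro u v h
    have h1 : (v.1.1 : ℕ) = (u.1.1 : ℕ) + 1 := h.1
    show (u.1.1 : ℕ) < (v.1.1 : ℕ)
    omega
  have hsink : ∀ v, ¬ (road w ℓ).edge (roadSink w ℓ hw) v := by
    intro v h
    have h1 : (v.1.1 : ℕ) = ℓ + 1 := h.1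
    have := v.1.1.2
    omega
  have hD : ∀ v ∈ (univ : Finset (road w ℓ).V).erase (roadSink w ℓ hw), ∀ u,
      (road w ℓ).edge u v → u ∈ (univ : Finset (road w ℓ).V).erase (roadSink w ℓ hw) := by
    intro v _ u hu
    refine Finset.mem_erase.mpr ⟨?_, Finset.mem_univ _⟩
    rintro rfl
    exact hsink v hu
  have h1 := reach_down r hr _ _ rfl hD
  refine reach_clear r hr (roadSink w ℓ hw) _ _ rfl (by simp) hD ?_
  refine h1.step (Or.inl ⟨roadSink w ℓ hw, by simp, ?_, rfl⟩)
  intro u hu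
  refine Finset.mem_erase.mpr ⟨?_, Finset.mem_univ _⟩
  rintro rfl
  exact hsink _ hu

lemma pers_bound (ℓ k : ℕ) (hw : 0 < w) (hk : NN w k ≤ ℓ + 1) :
    (k + 2) * w ≤ 2 * (road w ℓ).pers (roadSink w ℓ hw) := by
  have hne : { s : ℕ | ∃ P τ, (road w ℓ).IsRevPebbling P τ ∧ P τ = {roadSink w ℓ hw} ∧
      (road w ℓ).space P τ = s }.Nonempty := by
    obtain ⟨P, τ, h1, h2⟩ := reach_sink (w := w) ℓ hw
    exact ⟨_, P, τ, h1, h2, rfl⟩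
  obtain ⟨P, τ, h1, h2, h3⟩ := Nat.sInf_mem hne
  have := space_bound ℓ k hk P τ h1 h2
  unfold Dgraph.pers
  rw [← h3]
  exact this

end RoadAux

/-- Lower bound on the reversible pebbling price of roads
(Lemma `lem:chain-upper-bound`). -/
theorem road_pers_lower_bound (w ℓ : ℕ) (hw : 0 < w) (hℓ : w ≤ ℓ) :
    ((w : ℝ) / 2) * Real.logb 2 ((ℓ : ℝ) / (w : ℝ)) ≤
      ((road w ℓ).pers (roadSink w ℓ hw) : ℝ) := by
  haveI : NeZero w := ⟨hw.ne'⟩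
  have hwR : (0 : ℝ) < w := by exact_mod_cast hw
  have hlR : (0 : ℝ) < ℓ := by exact_mod_cast (lt_of_lt_of_le hw hℓ)
  have key : ∃ k, RoadAux.NN w k ≤ ℓ + 1 ∧ ℓ ≤ 2 ^ (k+2) * w := by
    have hex : ∃ k, ℓ + 1 < RoadAux.NN w k := by
      refine ⟨ℓ + 1, ?_⟩
      have h1 := RoadAux.NN_eq w (ℓ+1)
      have h2 : ℓ + 1 < 2 ^ (ℓ + 1) := Nat.lt_two_pow_self
      have h3 : 2 ^ (ℓ+1+1) = 2 * 2 ^ (ℓ+1) := by rw [pow_succ]; ring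
      rw [h3] at h1
      nlinarith
    have h1 := Nat.find_spec hex
    have h2 : ∀ m < Nat.find hex, ¬ _ := fun m hm => Nat.find_min hex hm
    generalize Nat.find hex = K at *
    cases K with
    | zero => simp only [RoadAux.NN] at h1; omega
    | succ k =>
      refine ⟨k, not_lt.mp (h2 k (by omega)), ?_⟩
      have := RoadAux.NN_eq w (k+1)
      rw [show k + 2 = k + 1 + 1 by omega]
      omega
  obtain ⟨k, hk1, hk2⟩ := key
  have hb := RoadAux.pers_bound (w := w) ℓ k hw hk1
  have hbR : ((k : ℝ) + 2) * w ≤ 2 * ((road w ℓ).pers (roadSink w ℓ hw) : ℝ) := by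
    exact_mod_cast hb
  have hlog : Real.logb 2 ((ℓ : ℝ) / w) ≤ (k : ℝ) + 2 := by
    rw [Real.logb_le_iff_le_rpow (by norm_num) (by positivity), div_le_iff₀ hwR]
    have : ((2:ℝ) ^ ((k:ℝ) + 2)) = 2 ^ (k+2) := by
      rw [← Real.rpow_natCast]; norm_num
    rw [this]
    exact_mod_cast hk2
  nlinarith [mul_le_mul_of_nonneg_left hlog hwR.le]
end

section
/- For every integer h ≥ 1, the persistent pebbling price of the directed path of length h (the DAG with vertices v₁,…,v_{h+1} and edges (vᵢ, vᵢ₊₁) for 1 ≤ i ≤ h) equals ⌊log₂ h⌋ + 2. -/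
/-! ### Pebbling the infinite path on `ℕ` -/

/-- One reversible move on the infinite path `0 → 1 → 2 → …`. -/
def PStep (P Q : Finset ℕ) : Prop :=
  ∃ v, (∀ u, u + 1 = v → u ∈ P) ∧ (∀ x, x ≠ v → (x ∈ Q ↔ x ∈ P)) ∧ (v ∈ Q ↔ v ∉ P)

/-- Reachability through configurations satisfying `C`. -/
def PReach (C : Finset ℕ → Prop) : Finset ℕ → Finset ℕ → Prop :=
  Relation.ReflTransGen fun P Q => PStep P Q ∧ C P ∧ C Q

/-- At most `k` pebbles. -/
def PC (k : ℕ) (P : Finset ℕ) : Prop := P.card ≤ k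

/-- At most `k` pebbles, all below `n`. -/
def PD (n k : ℕ) (P : Finset ℕ) : Prop := P.card ≤ k ∧ ∀ x ∈ P, x < n

theorem PStep.symm {P Q : Finset ℕ} (h : PStep P Q) : PStep Q P := by
  obtain ⟨v, h1, h2, h3⟩ := h
  refine ⟨v, fun u hu => (h2 u (by omega)).2 (h1 u hu), fun x hx => (h2 x hx).symm, ?_⟩
  tauto

theorem PReach.symm {C : Finset ℕ → Prop} {P Q : Finset ℕ} (h : PReach C P Q) :
    PReach C Q P := by
  induction h with
  | refl => exact Relation.ReflTransGen.refl
  | tail _ hbc ih =>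
    obtain ⟨h1, h2, h3⟩ := hbc
    exact Relation.ReflTransGen.head ⟨h1.symm, h3, h2⟩ ih

theorem PReach.lift {C D : Finset ℕ → Prop} (f : Finset ℕ → Finset ℕ)
    (hs : ∀ P Q, PStep P Q → C P → C Q → f P = f Q ∨ PStep (f P) (f Q))
    (hc : ∀ P, C P → D (f P)) {P Q : Finset ℕ} (h : PReach C P Q) :
    PReach D (f P) (f Q) := by
  induction h with
  | refl => exact Relation.ReflTransGen.refl
  | tail _ hbc ih =>
    obtain ⟨h1, h2, h3⟩ := hbc
    rcases hs _ _ h1 h2 h3 with h | h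
    · rw [← h]; exact ih
    · exact ih.tail ⟨h, hc _ h2, hc _ h3⟩

theorem PReach.mono {C D : Finset ℕ → Prop} (hc : ∀ P, C P → D P) {P Q : Finset ℕ}
    (h : PReach C P Q) : PReach D P Q :=
  PReach.lift id (fun _ _ h _ _ => Or.inr h) hc h

/-! ### Lower bound -/

theorem below_reach {k : ℕ} {P : Finset ℕ} (h : PReach (PC (k+1)) ∅ P) :
    ∀ m ∈ P, ∃ Q, (∀ u, u + 1 = m → u ∈ Q) ∧ PReach (PC k) Q (P.filter (· < m)) := by
  induction h with
  | refl => simp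
  | @tail b c _ hbc ih =>
    intro m hm
    obtain ⟨⟨v, h1, h2, h3⟩, hb, hc⟩ := hbc
    by_cases hmb : m ∈ b
    · obtain ⟨Q, hQ, hR⟩ := ih m hmb
      have hmv : m ≠ v := by rintro rfl; tauto
      have card : ∀ S : Finset ℕ, m ∈ S → PC (k+1) S → PC k (S.filter (· < m)) := by
        intro S hS hk
        have : (S.filter (· < m)).card < S.card :=
          Finset.card_lt_card (Finset.filter_ssubset.2 ⟨m, hS, by simp⟩)
        unfold PC at *; omega
      refine ⟨Q, hQ, ?_⟩
      by_cases hv : v < m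
      · refine hR.tail ⟨⟨v, ?_, ?_, ?_⟩, card _ hmb hb, card _ hm hc⟩
        · intro u hu
          simp only [Finset.mem_filter]
          exact ⟨h1 u hu, by omega⟩
        · intro x hx
          simp only [Finset.mem_filter, h2 x hx]
        · simp only [Finset.mem_filter]; tauto
      · have : c.filter (· < m) = b.filter (· < m) := by
          ext x
          simp only [Finset.mem_filter]
          by_cases hx : x = v
          · subst hx; tauto
          · rw [h2 x hx]
        rw [this]; exact hR
    · have hmv : m = v := by
        by_contra hne
        exact hmb ((h2 m hne).1 hm)
      subst hmv
      refine ⟨c.filter (· < m), ?_, Relation.ReflTransGen.refl⟩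
      intro u hu
      simp only [Finset.mem_filter]
      exact ⟨(h2 u (by omega)).2 (h1 u hu), by omega⟩

theorem min_bound {k : ℕ} (V : ∀ P, PReach (PC k) ∅ P → ∀ v ∈ P, v + 1 < 2 ^ k)
    {P : Finset ℕ} (h : PReach (PC (k+1)) ∅ P) (hP : P.Nonempty) : ∃ m ∈ P, m < 2 ^ k := by
  refine ⟨P.min' hP, P.min'_mem hP, ?_⟩
  obtain ⟨Q, hQ, hR⟩ := below_reach h _ (P.min'_mem hP)
  have he : P.filter (· < P.min' hP) = ∅ := by
    ext x
    simp only [Finset.mem_filter, Finset.notMem_empty, iff_false, not_and, not_lt]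
    exact fun hx => P.min'_le x hx
  rw [he] at hR
  cases hm : P.min' hP with
  | zero => positivity
  | succ u => exact V Q hR.symm u (hQ u hm.symm)

/-- Forget the first `M` vertices. -/
def pshift (M : ℕ) (P : Finset ℕ) : Finset ℕ := (P.filter (M ≤ ·)).image (· - M)

theorem mem_pshift {M x : ℕ} {P : Finset ℕ} : x ∈ pshift M P ↔ x + M ∈ P := by
  simp only [pshift, Finset.mem_image, Finset.mem_filter]
  constructor
  · rintro ⟨a, ⟨h1, h2⟩, rfl⟩
    rwa [Nat.sub_add_cancel h2]
  · intro h
    exact ⟨x + M, ⟨h, by omega⟩, by omega⟩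

theorem visit_bound (k : ℕ) : ∀ P, PReach (PC k) ∅ P → ∀ v ∈ P, v + 1 < 2 ^ k := by
  induction k with
  | zero =>
    intro P h
    rcases Relation.ReflTransGen.cases_tail h with h | ⟨b, _, _, _, h⟩
    · subst h; simp
    · have : P = ∅ := by simpa [PC] using h
      subst this; simp
  | succ k V =>
    intro P h
    have card : ∀ P, PReach (PC (k+1)) ∅ P → PC (k+1) P → PC k (pshift (2^k) P) := by
      intro P h hc
      by_cases hP : P.Nonempty
      · obtain ⟨m, hm, hlt⟩ := min_bound V h hP
        have h1 : (P.filter (2^k ≤ ·)).card < P.card :=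
          Finset.card_lt_card (Finset.filter_ssubset.2 ⟨m, hm, by simpa using hlt⟩)
        have h2 : (pshift (2^k) P).card ≤ (P.filter (2^k ≤ ·)).card := Finset.card_image_le
        unfold PC at *; omega
      · rw [Finset.not_nonempty_iff_eq_empty] at hP
        subst hP
        simp [PC, pshift]
    have key : PReach (PC k) ∅ (pshift (2^k) P) := by
      induction h with
      | refl => exact Relation.ReflTransGen.refl
      | @tail b c hb hbc ih =>
        have hc : PReach (PC (k+1)) ∅ c := Relation.ReflTransGen.tail hb hbc
        have cb := card b hb hbc.2.1
        have cc := card c hc hbc.2.2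
        obtain ⟨⟨v, h1, h2, h3⟩, -, -⟩ := hbc
        by_cases hv : 2 ^ k ≤ v
        · refine ih.tail ⟨⟨v - 2^k, ?_, ?_, ?_⟩, cb, cc⟩
          · intro u hu
            rw [mem_pshift]
            exact h1 _ (by omega)
          · intro x hx
            rw [mem_pshift, mem_pshift]
            exact h2 _ (by omega)
          · rw [mem_pshift, mem_pshift, Nat.sub_add_cancel hv]
            exact h3
        · have : pshift (2^k) c = pshift (2^k) b := by
            ext x
            rw [mem_pshift, mem_pshift]
            exact h2 _ (by omega)
          rw [this]; exact ih
    intro v hv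
    rw [pow_succ]
    by_cases h1 : 2 ^ k ≤ v
    · have := V _ key (v - 2^k) (by rw [mem_pshift, Nat.sub_add_cancel h1]; exact hv)
      omega
    · have : 0 < 2 ^ k := by positivity
      omega

theorem pers_lower {k h : ℕ} (hr : PReach (PC (k+1)) ∅ {h}) : h < 2 ^ k := by
  obtain ⟨m, hm, hlt⟩ := min_bound (visit_bound k) hr (by simp)
  simp only [Finset.mem_singleton] at hm
  omega

/-! ### Upper bound -/

theorem pers_of_visit {k : ℕ}
    (W : ∀ v, v + 1 < 2 ^ k → ∃ Q, v ∈ Q ∧ PReach (PD (v+1) k) ∅ Q)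
    (h : ℕ) (hh : h < 2 ^ k) : PReach (PD (h+1) (k+1)) ∅ {h} := by
  obtain ⟨Q, hQ, hR⟩ : ∃ Q, (∀ u, u + 1 = h → u ∈ Q) ∧ PReach (PD h k) ∅ Q := by
    cases h with
    | zero => exact ⟨∅, by simp, Relation.ReflTransGen.refl⟩
    | succ v =>
      obtain ⟨Q, h1, h2⟩ := W v hh
      refine ⟨Q, fun u hu => ?_, h2⟩
      have : u = v := by omega
      rw [this]; exact h1
  have hDQ : PD h k Q := by
    rcases Relation.ReflTransGen.cases_tail hR with h | ⟨b, _, _, _, h⟩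
    · subst h; simp [PD]
    · exact h
  have hins : ∀ P, PD h k P → PD (h+1) (k+1) (insert h P) := by
    rintro P ⟨h1, h2⟩
    refine ⟨(Finset.card_insert_le _ _).trans (by omega), fun x hx => ?_⟩
    rcases Finset.mem_insert.1 hx with hx | hx
    · omega
    · have := h2 x hx; omega
  have hwk : ∀ P, PD h k P → PD (h+1) (k+1) P := by
    rintro P ⟨h1, h2⟩
    exact ⟨by omega, fun x hx => by have := h2 x hx; omega⟩
  have r1 : PReach (PD (h+1) (k+1)) ∅ Q := hR.mono hwk
  have hnot : h ∉ Q := fun hx => by have := hDQ.2 h hx; omega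
  have r2 : PReach (PD (h+1) (k+1)) ∅ (insert h Q) := by
    refine r1.tail ⟨⟨h, hQ, ?_, ?_⟩, hwk _ hDQ, hins _ hDQ⟩
    · intro x hx; simp [hx]
    · simp [hnot]
  have r3 : PReach (PD (h+1) (k+1)) (insert h Q) (insert h ∅) := by
    refine PReach.lift (C := PD h k) (insert h) ?_ hins hR.symm
    rintro A B ⟨v, h1, h2, h3⟩ hA hB
    right
    have hvh : v ≠ h := by
      rintro rfl
      by_cases hv : v ∈ A
      · have := hA.2 v hv; omega
      · have := hB.2 v (h3.2 hv); omega
    refine ⟨v, fun u hu => Finset.mem_insert_of_mem (h1 u hu), ?_, ?_⟩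
    · intro x hx; simp [h2 x hx]
    · simp [hvh, h3]
  exact Relation.ReflTransGen.trans r2 r3

theorem visit_upper (k : ℕ) :
    ∀ v, v + 1 < 2 ^ k → ∃ Q, v ∈ Q ∧ PReach (PD (v+1) k) ∅ Q := by
  induction k with
  | zero => intro v hv; simp at hv
  | succ k W =>
    intro v hv
    rw [pow_succ] at hv
    rcases lt_or_ge v (2^k) with h | h
    · exact ⟨{v}, by simp, pers_of_visit W v h⟩
    · obtain ⟨M, hM⟩ : ∃ M, 2 ^ k = M + 1 :=
        Nat.exists_eq_succ_of_ne_zero (by positivity)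
      obtain ⟨Q, hQ, hR⟩ := W (v - 2^k) (by omega)
      have r1 : PReach (PD (v+1) (k+1)) ∅ {M} := by
        refine (pers_of_visit W M (by omega)).mono ?_
        rintro P ⟨h1, h2⟩
        exact ⟨h1, fun x hx => by have := h2 x hx; omega⟩
      refine ⟨insert M (Q.image (· + (M+1))), ?_, Relation.ReflTransGen.trans r1 ?_⟩
      · refine Finset.mem_insert_of_mem (Finset.mem_image.2 ⟨_, hQ, ?_⟩)
        show v - 2^k + (M+1) = v
        omega
      · have hmem : ∀ (P : Finset ℕ) x, x ∈ insert M (P.image (· + (M+1))) ↔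
            x = M ∨ (M + 1 ≤ x ∧ x - (M+1) ∈ P) := by
          intro P x
          simp only [Finset.mem_insert, Finset.mem_image]
          refine or_congr Iff.rfl ⟨?_, ?_⟩
          · rintro ⟨a, ha, rfl⟩
            exact ⟨by omega, by simpa using ha⟩
          · rintro ⟨h1, h2⟩
            exact ⟨_, h2, by omega⟩
        have := PReach.lift (D := PD (v+1) (k+1))
          (fun P => insert M (P.image (· + (M+1)))) ?_ ?_ hR
        · rw [Finset.image_empty] at this
          exact this
        · rintro A B ⟨w, h1, h2, h3⟩ - -
          right
          refine ⟨w + (M+1), ?_, ?_, ?_⟩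
          · intro u hu
            rw [hmem]
            by_cases hu' : u = M
            · exact Or.inl hu'
            · exact Or.inr ⟨by omega, h1 _ (by omega)⟩
          · intro x hx
            rw [hmem, hmem]
            refine or_congr Iff.rfl (and_congr_right fun hle => h2 _ (by omega))
          · rw [hmem, hmem]
            simp only [Nat.add_sub_cancel]
            have : w + (M+1) ≠ M := by omega
            simp [this, h3]
        · rintro P ⟨h1, h2⟩
          refine ⟨?_, ?_⟩
          · refine (Finset.card_insert_le _ _).trans ?_
            have : (P.image (· + (M+1))).card ≤ P.card := Finset.card_image_le
            omega
          · intro x hx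
            rcases (hmem P x).1 hx with hx | ⟨hx1, hx2⟩
            · omega
            · have := h2 _ hx2; omega

theorem pers_upper {k h : ℕ} (hh : h < 2 ^ k) : PReach (PD (h+1) (k+1)) ∅ {h} :=
  pers_of_visit (visit_upper k) h hh

/-! ### Transfer to `pathDag` -/

theorem fin_to_nat {h τ s : ℕ} {P : ℕ → Finset (Fin (h+1))}
    (hP : (pathDag h).IsRevPebbling P τ) (hs : ∀ t ≤ τ, (P t).card ≤ s) :
    ∀ t ≤ τ, PReach (PC s) ∅ ((P t).map Fin.valEmbedding) := by
  intro t
  induction t with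
  | zero =>
    intro _
    have h0 : P 0 = ∅ := hP.1
    rw [h0, Finset.map_empty]
    exact Relation.ReflTransGen.refl
  | succ t ih =>
    intro ht
    have hmem : ∀ (S : Finset (Fin (h+1))) (v : Fin (h+1)),
        (v : ℕ) ∈ S.map Fin.valEmbedding ↔ v ∈ S := by
      intro S v
      exact Finset.mem_map' Fin.valEmbedding
    refine (ih (by omega)).tail ⟨?_, ?_, ?_⟩
    · have hst := hP.2 t (by omega)
      have main : ∀ (v : Fin (h+1)), (∀ u : Fin (h+1), (v : ℕ) = u + 1 → u ∈ P t) →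
          (∀ x, x ≠ v → (x ∈ P (t+1) ↔ x ∈ P t)) → (v ∈ P (t+1) ↔ v ∉ P t) →
          PStep ((P t).map Fin.valEmbedding) ((P (t+1)).map Fin.valEmbedding) := by
        intro v h1 h2 h3
        refine ⟨v, ?_, ?_, ?_⟩
        · intro u hu
          have hv := v.2
          exact (hmem (P t) ⟨u, by omega⟩).2 (h1 ⟨u, by omega⟩ hu.symm)
        · intro x hx
          by_cases hlt : x < h + 1
          · have := h2 ⟨x, hlt⟩ (fun he => hx (by rw [← he]))
            exact ((hmem (P (t+1)) ⟨x, hlt⟩).trans this).trans (hmem (P t) ⟨x, hlt⟩).symm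
          · have hn : ∀ S : Finset (Fin (h+1)), x ∉ S.map Fin.valEmbedding := by
              intro S hxS
              obtain ⟨y, -, rfl⟩ := Finset.mem_map.1 hxS
              exact hlt y.2
            simp only [hn]
        · rw [hmem, hmem]; exact h3
      rcases hst with ⟨v, hv, hp, he⟩ | ⟨v, hv, hp, he⟩
      · refine main v hp (fun x hx => ?_) ?_
        · rw [he]
          exact ⟨fun hx' => (Finset.mem_insert.1 hx').resolve_left hx,
            fun hx' => Finset.mem_insert_of_mem hx'⟩
        · rw [he]
          exact ⟨fun _ => hv, fun _ => Finset.mem_insert_self _ _⟩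
      · refine main v hp (fun x hx => ?_) ?_
        · rw [he]
          exact ⟨fun hx' => Finset.mem_of_mem_erase hx',
            fun hx' => Finset.mem_erase_of_ne_of_mem hx hx'⟩
        · rw [he]
          exact ⟨fun h' => absurd h' (Finset.notMem_erase v _), fun h' => absurd hv h'⟩
    · unfold PC; rw [Finset.card_map]; exact hs t (by omega)
    · unfold PC; rw [Finset.card_map]; exact hs (t+1) ht

/-- Restrict a configuration to the first `h+1` vertices. -/
def toFin (h : ℕ) (P : Finset ℕ) : Finset (pathDag h).V :=
  (Finset.univ : Finset (Fin (h+1))).filter (fun i : Fin (h+1) => (i : ℕ) ∈ P)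

theorem mem_toFin {h : ℕ} {P : Finset ℕ} (i : Fin (h+1)) : i ∈ toFin h P ↔ (i : ℕ) ∈ P := by
  unfold toFin
  exact (Finset.mem_filter).trans (by simp)

theorem card_toFin {h : ℕ} {P : Finset ℕ} : (toFin h P).card ≤ P.card := by
  refine Finset.card_le_card_of_injOn (fun i : Fin (h+1) => (i : ℕ)) ?_ ?_
  · intro i hi
    exact (mem_toFin i).1 hi
  · intro i _ j _ hij
    exact Fin.ext hij

theorem step_toFin {h : ℕ} {P Q : Finset ℕ} (hPQ : PStep P Q) (hP : ∀ x ∈ P, x < h + 1)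
    (hQ : ∀ x ∈ Q, x < h + 1) : (pathDag h).RevStep (toFin h P) (toFin h Q) := by
  obtain ⟨v, h1, h2, h3⟩ := hPQ
  have hv : v < h + 1 := by
    by_cases hv : v ∈ P
    · exact hP v hv
    · exact hQ v (h3.2 hv)
  have hpred : ∀ u : (pathDag h).V, (pathDag h).edge u (⟨v, hv⟩ : Fin (h+1)) →
      u ∈ toFin h P := by
    intro u hu
    have hu' : v = Fin.val (n := h+1) u + 1 := hu
    exact (mem_toFin (h := h) u).2 (h1 _ hu'.symm)
  by_cases hvP : v ∈ P
  · right
    refine ⟨(⟨v, hv⟩ : Fin (h+1)), (mem_toFin (h := h) ⟨v, hv⟩).2 hvP, hpred, ?_⟩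
    apply Finset.ext
    intro (x : Fin (h+1))
    refine (mem_toFin x).trans (Iff.trans ?_ Finset.mem_erase.symm)
    refine Iff.trans ?_ (and_congr Iff.rfl (mem_toFin x).symm)
    by_cases hx : (x : ℕ) = v
    · constructor
      · intro hxQ; rw [hx] at hxQ; exact absurd hvP (h3.1 hxQ)
      · rintro ⟨hne, -⟩; exact absurd (Fin.ext hx) hne
    · rw [h2 _ hx]
      exact ⟨fun h' => ⟨fun he => hx (congrArg Fin.val he), h'⟩, fun h' => h'.2⟩
  · left
    refine ⟨(⟨v, hv⟩ : Fin (h+1)), fun h' => hvP ((mem_toFin (h := h) ⟨v, hv⟩).1 h'), hpred, ?_⟩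
    apply Finset.ext
    intro (x : Fin (h+1))
    refine (mem_toFin x).trans (Iff.trans ?_ Finset.mem_insert.symm)
    refine Iff.trans ?_ (or_congr Iff.rfl (mem_toFin x).symm)
    by_cases hx : (x : ℕ) = v
    · constructor
      · intro _; exact Or.inl (Fin.ext hx)
      · intro _; rw [hx]; exact h3.2 hvP
    · rw [h2 _ hx]
      exact ⟨Or.inr, fun h' => h'.resolve_left fun he => hx (congrArg Fin.val he)⟩

theorem nat_to_fin {h k : ℕ} {Q : Finset ℕ} (hr : PReach (PD (h+1) k) ∅ Q) :
    ∃ P τ, (pathDag h).IsRevPebbling P τ ∧ P τ = toFin h Q ∧ ∀ t ≤ τ, (P t).card ≤ k := by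
  induction hr with
  | refl =>
    have he : toFin h ∅ = ∅ := by
      apply Finset.eq_empty_of_forall_notMem
      intro (x : Fin (h+1)) hx
      exact absurd ((mem_toFin x).1 hx) (Finset.notMem_empty _)
    refine ⟨fun _ => toFin h ∅, 0, ⟨he, by simp⟩, rfl, fun t _ => ?_⟩
    show (toFin h ∅).card ≤ k
    rw [he]; simp
  | @tail b c _ hbc ih =>
    obtain ⟨P, τ, ⟨h0, hst⟩, hend, hcard⟩ := ih
    obtain ⟨hs, hb, hc⟩ := hbc
    refine ⟨fun t => if t ≤ τ then P t else toFin h c, τ + 1, ⟨?_, ?_⟩, ?_, ?_⟩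
    · simpa using h0
    · intro t ht
      by_cases hlt : t < τ
      · have h1 : t ≤ τ := by omega
        have h2 : t + 1 ≤ τ := by omega
        simp only [h1, h2, if_true]
        exact hst t hlt
      · have h1 : t = τ := by omega
        subst h1
        simp only [le_refl, if_true, show ¬ t + 1 ≤ t by omega, if_false, hend]
        exact step_toFin hs hb.2 hc.2
    · simp
    · intro t _
      by_cases hle : t ≤ τ
      · simp only [hle, if_true]; exact hcard t hle
      · simp only [hle, if_false]; exact card_toFin.trans hc.1

/-- The persistent pebbling price of the directed path of length `h ≥ 1` is
`⌊log₂ h⌋ + 2` (Lemma `lem:PathGraphs`). -/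
theorem path_pers (h : ℕ) (hh : 1 ≤ h) :
    (pathDag h).pers (pathSink h) = Nat.log 2 h + 2 := by
  have hup : h < 2 ^ (Nat.log 2 h + 1) := Nat.lt_pow_succ_log_self (by norm_num) h
  obtain ⟨P, τ, hP, hend, hcard⟩ := nat_to_fin (pers_upper hup)
  have hsing : toFin h {h} = {pathSink h} := by
    apply Finset.ext
    intro (x : Fin (h+1))
    refine (mem_toFin x).trans (Iff.trans ?_ Finset.mem_singleton.symm)
    rw [Finset.mem_singleton]
    exact ⟨fun hx => Fin.ext hx, fun hx => congrArg Fin.val hx⟩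
  have hmem : (pathDag h).space P τ ∈ { s : ℕ | ∃ P τ, (pathDag h).IsRevPebbling P τ ∧
      P τ = {pathSink h} ∧ (pathDag h).space P τ = s } :=
    ⟨P, τ, hP, hend.trans hsing, rfl⟩
  apply le_antisymm
  · refine (Nat.sInf_le hmem).trans (Finset.sup_le fun t ht => ?_)
    exact hcard t (by have := Finset.mem_range.1 ht; omega)
  · obtain ⟨P', τ', hP', hend', hs⟩ := Nat.sInf_mem ⟨_, hmem⟩
    have hle : ∀ t ≤ τ', (P' t).card ≤ (pathDag h).pers (pathSink h) := by
      intro t ht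
      refine le_trans ?_ (le_of_eq hs)
      exact Finset.le_sup (f := fun t => (P' t).card) (Finset.mem_range.2 (by omega))
    have hr := fin_to_nat hP' hle τ' le_rfl
    have h1 := hle τ' le_rfl
    rw [hend', Finset.card_singleton] at h1
    obtain ⟨k, hk⟩ : ∃ k, (pathDag h).pers (pathSink h) = k + 1 :=
      Nat.exists_eq_succ_of_ne_zero (by omega)
    rw [hend', hk] at hr
    have hm : Finset.map Fin.valEmbedding ({pathSink h} : Finset (pathDag h).V) = {h} :=
      Finset.map_singleton _ _
    have hr' : PReach (PC (k+1)) ∅ {h} := by rw [← hm]; exact hr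
    have hlt := pers_lower hr'
    have := Nat.log_lt_of_lt_pow (b := 2) (by omega : h ≠ 0) hlt
    omega
end

section
/- For every positive integer Δ and every integer h ≥ 0 with h ≤ g(Δ), the persistent pebbling price of the complete binary tree of height h is at most h + Δ. -/
namespace BT

variable {G : Dgraph}

/-- A reversible step touching a vertex of `R`, within space `s`. -/
def Stp (G : Dgraph) (R : Finset G.V) (s : ℕ) (P P' : Finset G.V) : Prop :=
  ∃ (v : G.V) (A : Finset G.V), v ∈ R ∧ v ∉ A ∧ (∀ u, G.edge u v → u ∈ A) ∧ A.card + 1 ≤ s ∧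
    ((P = A ∧ P' = insert v A) ∨ (P = insert v A ∧ P' = A))

/-- Reachability by steps inside the region `R` within space `s`. -/
def Reach (G : Dgraph) (R : Finset G.V) (s : ℕ) : Finset G.V → Finset G.V → Prop :=
  Relation.ReflTransGen (Stp G R s)

theorem Stp.symm {R : Finset G.V} {s : ℕ} {P P' : Finset G.V} (h : Stp G R s P P') :
    Stp G R s P' P := by
  obtain ⟨v, A, h1, h2, h3, h4, h5⟩ := h
  exact ⟨v, A, h1, h2, h3, h4, by tauto⟩

theorem Reach.symm {R : Finset G.V} {s : ℕ} {P P' : Finset G.V} (h : Reach G R s P P') :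
    Reach G R s P' P := by
  induction h with
  | refl => exact Relation.ReflTransGen.refl
  | tail _ h2 ih => exact Relation.ReflTransGen.head h2.symm ih

theorem Reach.trans {R : Finset G.V} {s : ℕ} {P P' P'' : Finset G.V} (h : Reach G R s P P')
    (h' : Reach G R s P' P'') : Reach G R s P P'' := Relation.ReflTransGen.trans h h'

theorem Reach.mono {R R' : Finset G.V} {s s' : ℕ} {P P' : Finset G.V} (h : Reach G R s P P')
    (hR : R ⊆ R') (hs : s ≤ s') : Reach G R' s' P P' := by
  refine Relation.ReflTransGen.mono ?_ _ _ h
  rintro a b ⟨v, A, h1, h2, h3, h4, h5⟩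
  exact ⟨v, A, hR h1, h2, h3, h4.trans hs, h5⟩

theorem Reach.frame {R : Finset G.V} {s : ℕ} {P P' : Finset G.V} (h : Reach G R s P P')
    {x : G.V} (hx : x ∉ R) : Reach G R (s + 1) (insert x P) (insert x P') := by
  refine Relation.ReflTransGen.lift (insert x) ?_ _ _ h
  rintro a b ⟨v, A, h1, h2, h3, h4, h5⟩
  have hvx : v ≠ x := fun e => hx (e ▸ h1)
  refine ⟨v, insert x A, h1, ?_, ?_, ?_, ?_⟩
  · simp [hvx, h2]
  · intro u hu
    exact Finset.mem_insert_of_mem (h3 u hu)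
  · have := Finset.card_insert_le x A
    omega
  · rcases h5 with ⟨rfl, rfl⟩ | ⟨rfl, rfl⟩
    · left; exact ⟨rfl, Finset.insert_comm _ _ _⟩
    · right; exact ⟨Finset.insert_comm _ _ _, rfl⟩

theorem Reach.outside {R : Finset G.V} {s : ℕ} {P P' : Finset G.V} (h : Reach G R s P P')
    {x : G.V} (hx : x ∉ R) : x ∈ P ↔ x ∈ P' := by
  induction h with
  | refl => rfl
  | tail _ h2 ih =>
    rw [ih]
    obtain ⟨v, A, h1, h2, h3, h4, h5⟩ := h2
    have hvx : x ≠ v := fun e => hx (e ▸ h1)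
    rcases h5 with ⟨rfl, rfl⟩ | ⟨rfl, rfl⟩ <;> simp [hvx]

theorem Reach.place {R : Finset G.V} {s : ℕ} {A : Finset G.V} {v : G.V} (h1 : v ∈ R)
    (h2 : v ∉ A) (h3 : ∀ u, G.edge u v → u ∈ A) (h4 : A.card + 1 ≤ s) :
    Reach G R s A (insert v A) :=
  Relation.ReflTransGen.single ⟨v, A, h1, h2, h3, h4, Or.inl ⟨rfl, rfl⟩⟩

/-- `v` is the root of a complete binary tree of height `h` contained in `S`. -/
inductive T (G : Dgraph) : ℕ → G.V → Finset G.V → Prop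
  | leaf (v : G.V) (S : Finset G.V) (hv : v ∈ S) (hp : ∀ u, ¬ G.edge u v) : T G 0 v S
  | node (h : ℕ) (v a b : G.V) (S A B : Finset G.V) (hv : v ∈ S) (hA : A ⊆ S) (hB : B ⊆ S)
      (hAB : Disjoint A B) (hvA : v ∉ A) (hvB : v ∉ B) (ha : T G h a A) (hb : T G h b B)
      (hp : ∀ u, G.edge u v → u = a ∨ u = b) : T G (h + 1) v S

theorem T.mem {h : ℕ} {v : G.V} {S : Finset G.V} (t : T G h v S) : v ∈ S := by
  cases t <;> assumption

/-- persistent bound for trees of height `h` -/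
def PersB (G : Dgraph) (h c : ℕ) : Prop :=
  ∀ (v : G.V) (S Q : Finset G.V) (s : ℕ), T G h v S → Disjoint Q S → Q.card + c ≤ s →
    Reach G S s Q (insert v Q)

/-- pebbling along a path, persistent version -/
theorem path_pers (R : Finset G.V) (w : ℕ → G.V) (k : ℕ) (U : Finset G.V)
    (hR : ∀ i ≤ k, w i ∈ R)
    (hinj : ∀ i ≤ k, ∀ j ≤ k, w i = w j → i = j)
    (hp : ∀ i < k, ∀ u, G.edge u (w (i + 1)) → u = w i ∨ u ∈ U) (n : ℕ) :
    ∀ (i : ℕ) (P : Finset G.V), i + 2 ^ n ≤ k → U ⊆ P → w i ∈ P →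
      (∀ j, i < j → j ≤ i + 2 ^ n → w j ∉ P) →
      Reach G R (P.card + n + 1) P (insert (w (i + 2 ^ n)) P) := by
  induction n with
  | zero =>
    intro i P hk hU hw hn
    refine Reach.place (hR _ hk) (hn _ (by simp) le_rfl) ?_ (by simp)
    intro u hu
    rcases hp i (by simpa using hk) u (by simpa using hu) with rfl | h
    · exact hw
    · exact hU h
  | succ n ih =>
    intro i P hk hU hw hn
    have h2 : 2 ^ (n + 1) = 2 ^ n + 2 ^ n := by ring
    have hpos : 0 < 2 ^ n := by positivity
    rw [h2] at hk hn ⊢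
    have e1 := ih i P (by omega) hU hw (fun j h1 h2 => hn j h1 (by omega))
    have hm : w (i + 2 ^ n) ∉ P := hn _ (by omega) (by omega)
    have e2 := ih (i + 2 ^ n) (insert (w (i + 2 ^ n)) P) (by omega)
      (hU.trans (Finset.subset_insert _ _)) (Finset.mem_insert_self _ _) (by
        intro j h1 h2 hj
        rcases Finset.mem_insert.1 hj with h | h
        · have := hinj _ (by omega) _ (by omega) h
          omega
        · exact hn j (by omega) (by omega) h)
    have hm2 : w (i + 2 ^ n + 2 ^ n) ∉ P := hn _ (by omega) (by omega)
    have e3 := ih i (insert (w (i + 2 ^ n + 2 ^ n)) P) (by omega)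
      (hU.trans (Finset.subset_insert _ _)) (Finset.mem_insert_of_mem hw) (by
        intro j h1 h2 hj
        rcases Finset.mem_insert.1 hj with h | h
        · have := hinj _ (by omega) _ (by omega) h
          omega
        · exact hn j (by omega) (by omega) h)
    rw [Finset.card_insert_of_notMem hm] at e2
    rw [Finset.card_insert_of_notMem hm2, Finset.insert_comm] at e3
    rw [← add_assoc i]
    exact ((e1.mono subset_rfl (by omega)).trans (e2.mono subset_rfl (by omega))).trans
      (e3.symm.mono subset_rfl (by omega))

/-- pebbling along a path, visiting version -/
theorem path_visit (R : Finset G.V) (w : ℕ → G.V) (k : ℕ) (U : Finset G.V)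
    (hR : ∀ i ≤ k, w i ∈ R)
    (hinj : ∀ i ≤ k, ∀ j ≤ k, w i = w j → i = j)
    (hp : ∀ i < k, ∀ u, G.edge u (w (i + 1)) → u = w i ∨ u ∈ U) (n : ℕ) :
    ∀ (i : ℕ) (P : Finset G.V), i ≤ k → k + 1 ≤ i + 2 ^ n → U ⊆ P → w i ∈ P →
      (∀ j, i < j → j ≤ k → w j ∉ P) →
      ∃ P', Reach G R (P.card + n) P P' ∧ P ⊆ P' ∧ w k ∈ P' ∧ P'.card ≤ P.card + n := by
  induction n with
  | zero =>
    intro i P hk hk2 hU hw hn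
    have : i = k := by simp at hk2; omega
    subst this
    exact ⟨P, Relation.ReflTransGen.refl, subset_rfl, hw, by simp⟩
  | succ n ih =>
    intro i P hk hk2 hU hw hn
    have h2 : 2 ^ (n + 1) = 2 ^ n + 2 ^ n := by ring
    have hpos : 0 < 2 ^ n := by positivity
    rw [h2] at hk2
    by_cases hc : k + 1 ≤ i + 2 ^ n
    · obtain ⟨P', a1, a2, a3, a4⟩ := ih i P hk hc hU hw hn
      exact ⟨P', a1.mono subset_rfl (by omega), a2, a3, by omega⟩
    · have e1 := path_pers R w k U hR hinj hp n i P (by omega) hU hw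
        (fun j h1 h2 => hn j h1 (by omega))
      have hm : w (i + 2 ^ n) ∉ P := hn _ (by omega) (by omega)
      obtain ⟨P', a1, a2, a3, a4⟩ := ih (i + 2 ^ n) (insert (w (i + 2 ^ n)) P) (by omega)
        (by omega) (hU.trans (Finset.subset_insert _ _)) (Finset.mem_insert_self _ _) (by
        intro j h1 h2 hj
        rcases Finset.mem_insert.1 hj with h | h
        · have := hinj _ (by omega) _ (by omega) h
          omega
        · exact hn j (by omega) (by omega) h)
      rw [Finset.card_insert_of_notMem hm] at a1 a4
      exact ⟨P', (e1.mono subset_rfl (by omega)).trans (a1.mono subset_rfl (by omega)),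
        (Finset.subset_insert _ _).trans a2, a3, by omega⟩

/-- Pebble all the siblings along a root-to-depth-`k` path, and the bottom vertex. -/
theorem spine (m D : ℕ) (hm : PersB G m (m + D)) (k : ℕ) :
    ∀ (x : G.V) (S Q : Finset G.V) (s : ℕ), T G (m + k) x S → Disjoint Q S →
      (∀ l < k, PersB G (m + l) (m + l + D + 1)) → Q.card + k + m + D ≤ s →
      ∃ (w : ℕ → G.V) (P : Finset G.V), w k = x ∧ w 0 ∈ P ∧
        (∀ i, 0 < i → i ≤ k → w i ∉ P) ∧ (∀ i ≤ k, w i ∈ S) ∧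
        (∀ i ≤ k, ∀ j ≤ k, w i = w j → i = j) ∧
        (∀ i < k, ∀ u, G.edge u (w (i + 1)) → u = w i ∨ u ∈ P) ∧
        Reach G S s Q P ∧ P.card = Q.card + k + 1 ∧ Q ⊆ P := by
  induction k with
  | zero =>
    intro x S Q s t hd _ hs
    have hx : x ∉ Q := fun h => Finset.disjoint_left.1 hd h t.mem
    refine ⟨fun _ => x, insert x Q, rfl, by simp, by intros; omega, fun _ _ => t.mem,
      by intros; omega, by intros; omega, hm x S Q s t hd (by omega), ?_, by simp⟩
    simp [Finset.card_insert_of_notMem hx]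
  | succ k ih =>
    intro x S Q s t hd hl hs
    rw [← add_assoc] at t
    obtain _ | ⟨_, _, a, b, _, A, B, hv, hA, hB, hAB, hvA, hvB, ha, hb, hp⟩ := t
    have haQ : a ∉ Q := fun h => Finset.disjoint_left.1 hd h (hA ha.mem)
    have e1 := hl k (by omega) a A Q s ha (hd.mono_right hA) (by omega)
    have hd2 : Disjoint (insert a Q) B := by
      rw [Finset.disjoint_insert_left]
      exact ⟨Finset.disjoint_left.1 hAB ha.mem, hd.mono_right hB⟩
    obtain ⟨w, P, w1, w2, w3, w4, w5, w6, w7, w8, w9⟩ := ih b B (insert a Q) s hb hd2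
      (fun l h => hl l (by omega)) (by rw [Finset.card_insert_of_notMem haQ]; omega)
    rw [Finset.card_insert_of_notMem haQ] at w8
    have hxP : x ∉ P := by
      rw [← w7.outside hvB, Finset.mem_insert, not_or]
      exact ⟨fun e => hvA (e ▸ ha.mem), fun h => Finset.disjoint_left.1 hd h hv⟩
    have hxw : ∀ i ≤ k, w i ≠ x := fun i hi e => hvB (e ▸ w4 i hi)
    refine ⟨fun i => if i ≤ k then w i else x, P, by simp, by simpa using w2, ?_, ?_, ?_, ?_,
      (e1.mono hA le_rfl).trans (w7.mono hB le_rfl), by omega,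
      (Finset.subset_insert _ _).trans w9⟩
    · intro i h0 h1
      dsimp only
      split_ifs with h
      · exact w3 i h0 h
      · exact hxP
    · intro i h1
      dsimp only
      split_ifs with h
      · exact hB (w4 i h)
      · exact hv
    · intro i hi j hj
      dsimp only
      split_ifs with h h' h'
      · exact w5 i h j h'
      · exact fun e => absurd e (hxw i h)
      · exact fun e => absurd e.symm (hxw j h')
      · intros; omega
    · intro i hi u
      dsimp only
      rw [if_pos (show i ≤ k by omega)]
      split_ifs with h
      · exact w6 i (by omega) u
      · intro hu
        have : i = k := by omega
        subst this
        rcases hp u hu with rfl | rfl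
        · exact Or.inr (w9 (Finset.mem_insert_self _ _))
        · exact Or.inl w1.symm

theorem pers_step (m n k : ℕ) (hm : PersB G m (m + (n + 1)))
    (hl : ∀ l ≤ k, PersB G (m + l) (m + l + (n + 1) + 1)) (hk : k + 1 ≤ 2 ^ (m + n)) :
    PersB G (m + k + 1) (m + k + 1 + (n + 2)) := by
  intro v S Q s t hd hs
  obtain _ | ⟨_, _, a, b, _, A, B, hv, hA, hB, hAB, hvA, hvB, ha, hb, hp⟩ := t
  have haQ : a ∉ Q := fun h => Finset.disjoint_left.1 hd h (hA ha.mem)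
  have e1 := hl k le_rfl a A Q (s - 1) ha (hd.mono_right hA) (by omega)
  have hd2 : Disjoint (insert a Q) B := by
    rw [Finset.disjoint_insert_left]
    exact ⟨Finset.disjoint_left.1 hAB ha.mem, hd.mono_right hB⟩
  obtain ⟨w, P, w1, w2, w3, w4, w5, w6, w7, w8, w9⟩ := spine m (n + 1) hm k b B (insert a Q)
    (s - 1) hb hd2 (fun l h => hl l (by omega))
    (by rw [Finset.card_insert_of_notMem haQ]; omega)
  rw [Finset.card_insert_of_notMem haQ] at w8
  obtain ⟨P', p1, p2, p3, p4⟩ := path_visit B w k P w4 w5 w6 (m + n) 0 P (by omega) (by omega)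
    subset_rfl w2 w3
  have hR : Reach G (A ∪ B) (s - 1) Q P' :=
    ((e1.mono Finset.subset_union_left le_rfl).trans
      (w7.mono Finset.subset_union_right le_rfl)).trans
      (p1.mono Finset.subset_union_right (by omega))
  have hvAB : v ∉ A ∪ B := by simp [hvA, hvB]
  have hvQ : v ∉ Q := fun h => Finset.disjoint_left.1 hd h hv
  have hvP' : v ∉ P' := by rwa [← hR.outside hvAB]
  have hS : A ∪ B ⊆ S := Finset.union_subset hA hB
  have hpl : Reach G S s P' (insert v P') := by
    refine Reach.place hv hvP' ?_ (by omega)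
    intro u hu
    rcases hp u hu with rfl | rfl
    · exact p2 (w9 (Finset.mem_insert_self _ _))
    · exact w1 ▸ p3
  exact ((hR.mono hS (by omega)).trans hpl).trans ((hR.frame hvAB).symm.mono hS (by omega))

theorem persB_mono {h c c' : ℕ} (hp : PersB G h c) (hc : c ≤ c') : PersB G h c' :=
  fun v S Q s t hd hs => hp v S Q s t hd (by omega)

theorem main (n : ℕ) : ∀ h ≤ g (n + 1), PersB G h (h + (n + 1)) := by
  induction n with
  | zero =>
    intro h hh v S Q s t hd hs
    have : h = 0 := by simpa [g] using hh
    subst this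
    obtain ⟨_, _, hv, hp⟩ | _ := t
    exact Reach.place hv (fun h => Finset.disjoint_left.1 hd h hv)
      (fun u hu => absurd hu (hp u)) (by omega)
  | succ n ih =>
    intro h
    induction h using Nat.strong_induction_on with
    | _ h ihh =>
      intro hh
      by_cases hc : h ≤ g (n + 1)
      · exact persB_mono (ih h hc) (by omega)
      · obtain ⟨k, rfl⟩ : ∃ k, h = g (n + 1) + k + 1 := ⟨h - g (n + 1) - 1, by omega⟩
        have hg : g (n + 1 + 1) = 2 ^ (g (n + 1) + n) + g (n + 1) := rfl
        refine pers_step (g (n + 1)) n k (ih _ le_rfl) (fun l hl => ?_) (by omega)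
        exact persB_mono (ihh (g (n + 1) + l) (by omega) (by omega)) (by omega)

theorem reach_seq {R : Finset G.V} {s : ℕ} {P P' : Finset G.V} (h : Reach G R s P P')
    (h0 : P.card ≤ s) : ∃ (f : ℕ → Finset G.V) (τ : ℕ), f 0 = P ∧ f τ = P' ∧
      (∀ t < τ, G.RevStep (f t) (f (t + 1))) ∧ ∀ t ≤ τ, (f t).card ≤ s := by
  induction h with
  | refl => exact ⟨fun _ => P, 0, rfl, rfl, by intros; omega, fun _ _ => h0⟩
  | @tail b c _ h2 ih =>
    obtain ⟨f, τ, f0, f1, f2, f3⟩ := ih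
    refine ⟨fun t => if t ≤ τ then f t else c, τ + 1, by simpa using f0, by simp, ?_, ?_⟩
    · intro t ht
      dsimp only
      rw [if_pos (show t ≤ τ by omega)]
      split_ifs with h
      · exact f2 t (by omega)
      · have : t = τ := by omega
        subst this
        rw [f1]
        obtain ⟨v, A, h1, h2, h3, h4, ⟨rfl, rfl⟩ | ⟨rfl, rfl⟩⟩ := h2
        · exact Or.inl ⟨v, h2, h3, rfl⟩
        · exact Or.inr ⟨v, by simp, fun u hu => Finset.mem_insert_of_mem (h3 u hu),
            (Finset.erase_insert h2).symm⟩
    · intro t ht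
      dsimp only
      split_ifs with h
      · exact f3 t h
      · obtain ⟨v, A, h1, h2, h3, h4, ⟨rfl, rfl⟩ | ⟨rfl, rfl⟩⟩ := h2
        · rw [Finset.card_insert_of_notMem h2]; exact h4
        · omega

/-- descendants of the `j`-th vertex at depth `d` -/
def desc (H d j : ℕ) : Finset (bintree H).V :=
  Finset.univ.filter fun u : (bintree H).V =>
    d ≤ (u.1 : ℕ) ∧ (u.2 : ℕ) / 2 ^ ((u.1 : ℕ) - d) = j

theorem mem_desc (H d j : ℕ) (u : (bintree H).V) :
    u ∈ desc H d j ↔ d ≤ (u.1 : ℕ) ∧ (u.2 : ℕ) / 2 ^ ((u.1 : ℕ) - d) = j := by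
  unfold desc
  rw [Finset.mem_filter]
  simp

theorem desc_sub (H d j i : ℕ) (hi : i / 2 = j) : desc H (d + 1) i ⊆ desc H d j := by
  intro u hu
  rw [mem_desc] at hu ⊢
  refine ⟨by omega, ?_⟩
  have : (u.1 : ℕ) - d = (u.1 : ℕ) - (d + 1) + 1 := by omega
  rw [this, pow_succ, ← Nat.div_div_eq_div_mul, hu.2, hi]

/-- the `j`-th vertex at depth `d` -/
def vx (H : ℕ) (d : Fin (H + 1)) (j : Fin (2 ^ (d : ℕ))) : (bintree H).V := ⟨d, j⟩

theorem self_desc (H : ℕ) (d : Fin (H + 1)) (j : Fin (2 ^ (d : ℕ))) :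
    vx H d j ∈ desc H d j := by
  refine (mem_desc _ _ _ _).2 ?_
  show (d : ℕ) ≤ d ∧ (j : ℕ) / 2 ^ ((d : ℕ) - d) = j
  simp

theorem mk_eq {H : ℕ} {u : (bintree H).V} {d : Fin (H + 1)} {j : Fin (2 ^ (d : ℕ))}
    (h1 : (u.1 : ℕ) = d) (h2 : (u.2 : ℕ) = j) : u = vx H d j := by
  obtain ⟨a, b⟩ := u
  have : a = d := Fin.ext h1
  subst this
  have : b = j := Fin.ext h2
  subst this
  rfl

theorem tree (H h : ℕ) : ∀ (d : Fin (H + 1)) (j : Fin (2 ^ (d : ℕ))), (d : ℕ) + h = H →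
    T (bintree H) h (vx H d j) (desc H d j) := by
  induction h with
  | zero =>
    intro d j hd
    refine T.leaf _ _ (self_desc H d j) ?_
    rintro u ⟨h1, _⟩
    have := u.1.2
    change (u.1 : ℕ) = (d : ℕ) + 1 at h1
    omega
  | succ h ih =>
    intro d j hd
    have hj := j.2
    have hpow : 2 ^ ((d : ℕ) + 1) = 2 ^ (d : ℕ) * 2 := pow_succ _ _
    let d' : Fin (H + 1) := ⟨d + 1, by omega⟩
    let a : Fin (2 ^ (d' : ℕ)) := ⟨2 * j, by show 2 * (j : ℕ) < 2 ^ ((d : ℕ) + 1); omega⟩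
    let b : Fin (2 ^ (d' : ℕ)) := ⟨2 * j + 1, by show 2 * (j : ℕ) + 1 < 2 ^ ((d : ℕ) + 1); omega⟩
    refine T.node h _ (vx H d' a) (vx H d' b) _ (desc H d' a) (desc H d' b)
      (self_desc H d j) (desc_sub _ _ _ _ ?_) (desc_sub _ _ _ _ ?_) ?_ ?_ ?_
      (ih d' a ?_) (ih d' b ?_) ?_
    · show 2 * (j : ℕ) / 2 = j
      omega
    · show (2 * (j : ℕ) + 1) / 2 = j
      omega
    · rw [Finset.disjoint_left]
      intro u h1 h2
      rw [mem_desc] at h1 h2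
      have h3 := h1.2.symm.trans h2.2
      change 2 * (j : ℕ) = 2 * j + 1 at h3
      omega
    · intro h1
      have h1 := (mem_desc _ _ _ _).1 h1
      have h3 : (d : ℕ) + 1 ≤ d := h1.1
      omega
    · intro h1
      have h1 := (mem_desc _ _ _ _).1 h1
      have h3 : (d : ℕ) + 1 ≤ d := h1.1
      omega
    · show (d : ℕ) + 1 + h = H
      omega
    · show (d : ℕ) + 1 + h = H
      omega
    · rintro u ⟨h1, h2⟩
      change (u.1 : ℕ) = (d : ℕ) + 1 at h1
      change (u.2 : ℕ) / 2 = (j : ℕ) at h2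
      have : (u.2 : ℕ) = 2 * j ∨ (u.2 : ℕ) = 2 * j + 1 := by omega
      rcases this with h | h
      · exact Or.inl (mk_eq h1 h)
      · exact Or.inr (mk_eq h1 h)

end BT

/-- Upper bound on the persistent pebbling price of complete binary trees
(Lemma `lem:UpperBound`). -/
theorem bintree_pers_upper (Δ : ℕ) (hΔ : 1 ≤ Δ) (h : ℕ) (hh : h ≤ g Δ) :
    (bintree h).pers (bintreeRoot h) ≤ h + Δ := by
  obtain ⟨n, rfl⟩ : ∃ n, Δ = n + 1 := ⟨Δ - 1, by omega⟩
  have ht : BT.T (bintree h) h (bintreeRoot h) (BT.desc h 0 0) :=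
    BT.tree h h 0 ⟨0, by positivity⟩ (by simp)
  have hr := BT.main (G := bintree h) n h hh (bintreeRoot h) _ ∅ (h + (n + 1)) ht
    (Finset.disjoint_empty_left _) (by simp)
  obtain ⟨f, τ, f0, f1, f2, f3⟩ := BT.reach_seq hr (by simp)
  have h1 : (bintree h).pers (bintreeRoot h) ≤ (bintree h).space f τ :=
    Nat.sInf_le ⟨f, τ, ⟨f0, f2⟩, by simpa using f1, rfl⟩
  refine h1.trans (Finset.sup_le fun t ht => f3 t ?_)
  have := Finset.mem_range.1 ht
  omega
end
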